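/- arXiv:2001.03312 — 3 statements merged into one kernel-verified Lean document; each statement's English description precedes it below -/
import Mathlib

section
/- Let A be a (not necessarily commutative) ring. If the Laurent series ring A((x)) is a right serial ring, then A is a right serial right Artinian ring. -/
/-- A module is *uniserial* if any two of its submodules are comparable with
respect to inclusion. -/
def IsUniserialModule (R M : Type*) [Ring R] [AddCommGroup M] [Module R M] : Prop :=
  ∀ N₁ N₂ : Submodule R M, N₁ ≤ N₂ ∨ N₂ ≤ N₁

/-- A ring `A` is *right serial* if `A` is a finite direct sum of uniserial right
ideals, i.e. the right module `A_A` is a serial module.  Right ideals of `A` are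
the submodules of `A` viewed as a right module over itself, i.e. as a module
over the opposite ring `Aᵐᵒᵖ`. -/
def IsRightSerialRing (A : Type*) [Ring A] : Prop :=
  ∃ (ι : Type) (_ : Fintype ι) (N : ι → Submodule Aᵐᵒᵖ A),
    iSupIndep N ∧ (⨆ i, N i) = ⊤ ∧ ∀ i, IsUniserialModule Aᵐᵒᵖ (N i)

/-- A ring `A` is *left serial* if `A` is a finite direct sum of uniserial left
ideals, i.e. the left module `_AA` is a serial module. -/
def IsLeftSerialRing (A : Type*) [Ring A] : Prop :=
  ∃ (ι : Type) (_ : Fintype ι) (N : ι → Submodule A A),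
    iSupIndep N ∧ (⨆ i, N i) = ⊤ ∧ ∀ i, IsUniserialModule A (N i)

/-- A module `M` is *finite-dimensional* if it contains no infinite direct sum of
nonzero submodules, i.e. there is no infinite independent family of nonzero
submodules of `M`. -/
def IsFinDimModule (R M : Type*) [Ring R] [AddCommGroup M] [Module R M] : Prop :=
  ¬ ∃ (ι : Type) (_ : Infinite ι) (N : ι → Submodule R M),
      (∀ i, N i ≠ ⊥) ∧ iSupIndep N

/-- A module `M` is *quotient finite-dimensional* if every factor module of `M`
is finite-dimensional. -/
def IsQFDModule (R M : Type*) [Ring R] [AddCommGroup M] [Module R M] : Prop :=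
  ∀ N : Submodule R M, IsFinDimModule R (M ⧸ N)

theorem IsUniserialModule.le_or_le {R M : Type*} [Ring R] [AddCommGroup M] [Module R M]
    {K X Y : Submodule R M} (hK : IsUniserialModule R K) (hX : X ≤ K) (hY : Y ≤ K) :
    X ≤ Y ∨ Y ≤ X := by
  rcases hK (X.comap K.subtype) (Y.comap K.subtype) with h | h
  · exact .inl fun x hx => h (show (⟨x, hX hx⟩ : K) ∈ X.comap K.subtype from hx)
  · exact .inr fun x hx => h (show (⟨x, hY hx⟩ : K) ∈ Y.comap K.subtype from hx)

/-- If the uniserial submodules `K i` span `M`, then a family of elements `f j` of `M` with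
submodules `L j` such that `f l ∈ L j` exactly when `l ≠ j` has at most as many members as there
are `K i`. -/
theorem card_le_card_of_isUniserialModule {R M ι κ : Type*} [Ring R] [AddCommGroup M] [Module R M]
    {K : ι → Submodule R M} (hK : ∀ i, IsUniserialModule R (K i)) (hsup : ⨆ i, K i = ⊤)
    (f : κ → M) (s : Finset ι) (t : Finset κ) (L : κ → Submodule R M)
    (hLK : ∀ j ∈ t, ∀ i ∉ s, K i ≤ L j) (hnot : ∀ j ∈ t, f j ∉ L j)
    (hmem : ∀ j ∈ t, ∀ l ∈ t, l ≠ j → f l ∈ L j) : t.card ≤ s.card := by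
  classical
  induction s using Finset.induction_on generalizing t L with
  | empty =>
    rcases t.eq_empty_or_nonempty with rfl | ⟨j, hj⟩
    · simp
    · have : L j = ⊤ := top_unique (hsup ▸ iSup_le fun i => hLK j hj i (by simp))
      exact absurd (this ▸ Submodule.mem_top) (hnot j hj)
  | insert i s his ih =>
    rcases t.eq_empty_or_nonempty with rfl | ht
    · simp
    obtain ⟨j, hj, hmin⟩ : ∃ j ∈ t, ∀ l ∈ t, K i ⊓ L j ≤ K i ⊓ L l := by
      obtain ⟨j, hj, hmin⟩ := Finset.exists_minimalFor (fun l => K i ⊓ L l) t ht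
      refine ⟨j, hj, fun l hl => ?_⟩
      rcases (hK i).le_or_le (inf_le_left : K i ⊓ L j ≤ K i) (inf_le_left : K i ⊓ L l ≤ K i)
        with h | h
      · exact h
      · exact hmin hl h
    have key := ih (t.erase j) (fun l => (L l ⊓ L j) ⊔ K i) ?_ ?_ ?_
    · rw [Finset.card_erase_of_mem hj] at key
      rw [Finset.card_insert_of_notMem his]
      omega
    · intro l hl i' hi'
      by_cases h : i' = i
      · subst h; exact le_sup_right
      · have hi : i' ∉ insert i s := by simp [h, hi']
        exact (le_inf (hLK l (Finset.mem_of_mem_erase hl) i' hi) (hLK j hj i' hi)).trans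
          le_sup_left
    · intro l hl hfl
      have hlt := Finset.mem_of_mem_erase hl
      obtain ⟨y, hy, k, hk, hyk⟩ := Submodule.mem_sup.1 hfl
      have hkj : k ∈ L j := by
        rw [← add_sub_cancel_left y k, hyk]
        exact sub_mem (hmem j hj l hlt (Finset.ne_of_mem_erase hl)) hy.2
      exact hnot l hlt (hyk ▸ add_mem hy.1 (hmin l hlt ⟨hk, hkj⟩).2)
    · intro l hl m hm hml
      exact Submodule.mem_sup_left
        ⟨hmem l (Finset.mem_of_mem_erase hl) m (Finset.mem_of_mem_erase hm) hml,
          hmem j hj m (Finset.mem_of_mem_erase hm) (Finset.ne_of_mem_erase hm)⟩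

/-- A right serial ring admits no arbitrarily large families of elements that are independent of
each other in the sense of `card_le_card_of_isUniserialModule`. -/
theorem IsRightSerialRing.exists_bound {R : Type*} [Ring R] (h : IsRightSerialRing R) :
    ∃ n : ℕ, ∀ (f : ℕ → R) (L : ℕ → Submodule Rᵐᵒᵖ R),
      (∀ j ≤ n, ∀ l ≤ n, l ≠ j → f l ∈ L j) → ∃ j ≤ n, f j ∈ L j := by
  obtain ⟨ι, _, K, -, hsup, hK⟩ := h
  refine ⟨Fintype.card ι, fun f L hmem => ?_⟩
  by_contra! hnot
  have := card_le_card_of_isUniserialModule hK hsup f Finset.univ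
    (Finset.range (Fintype.card ι + 1)) L (by simp)
    (fun j hj => hnot j (by simpa [Nat.lt_succ_iff] using hj))
    (fun j hj l hl => hmem j (by simpa [Nat.lt_succ_iff] using hj) l
      (by simpa [Nat.lt_succ_iff] using hl))
  simp at this

theorem LaurentSeries.coeff_mul_mem {A : Type*} [Ring A] (B : AddSubgroup A)
    (f g : LaurentSeries A) (p : ℤ) (h : ∀ i j, i + j = p → f.coeff i * g.coeff j ∈ B) :
    (f * g).coeff p ∈ B := by
  rw [HahnSeries.coeff_mul]
  exact sum_mem fun ij hij => h _ _ (Finset.mem_antidiagonal.1 hij).2.2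

theorem isNoetherian_of_laurentSeries {A : Type*} [Ring A]
    (h : IsRightSerialRing (LaurentSeries A)) : IsNoetherian Aᵐᵒᵖ A := by
  obtain ⟨n, hn⟩ := h.exists_bound
  by_contra hwf
  rw [isNoetherian_iff, RelEmbedding.wellFounded_iff_isEmpty, not_isEmpty_iff] at hwf
  obtain ⟨F⟩ := hwf
  let B : ℕ → Submodule Aᵐᵒᵖ A := F
  have hB : StrictMono B := fun i j hij => F.map_rel_iff.2 hij
  have hex : ∀ i, ∃ a, a ∈ B (i + 1) ∧ a ∉ B i := fun i => SetLike.exists_of_lt (hB i.lt_succ_self)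
  choose a ha ha' using hex
  let c : ℕ → ℤ → A := fun j p =>
    if p = ((p.toNat.sqrt : ℤ)) ^ 2 ∧ p.toNat.sqrt % (n + 1) = j then a p.toNat.sqrt else 0
  let f : ℕ → LaurentSeries A := fun j => HahnSeries.ofSuppBddBelow (c j) ⟨0, by
    intro p hp
    by_contra hneg
    refine hp (if_neg fun hp' => hneg ?_)
    rw [hp'.1]
    positivity⟩
  have hf : ∀ j p, (f j).coeff p = c j p := fun j p => rfl
  have hfsq : ∀ j (i : ℕ), i % (n + 1) = j → (f j).coeff ((i : ℤ) ^ 2) = a i := by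
    intro j i hij
    have : ((i : ℤ) ^ 2).toNat.sqrt = i := by
      rw [← Nat.cast_pow, Int.toNat_natCast, Nat.sqrt_eq']
    rw [hf]
    simp only [c, this, hij, and_self, if_true]
  let L : ℕ → Submodule (LaurentSeries A)ᵐᵒᵖ (LaurentSeries A) := fun j =>
    { carrier := {g | ∀ m : ℕ, ∃ k : ℕ, ∀ i, k ≤ i → i % (n + 1) = j →
        ∀ p : ℤ, p ≤ (i : ℤ) ^ 2 + m → g.coeff p ∈ B i}
      add_mem' := by
        intro g g' hg hg' m
        obtain ⟨k, hk⟩ := hg m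
        obtain ⟨k', hk'⟩ := hg' m
        refine ⟨max k k', fun i hi hij p hp => ?_⟩
        exact add_mem (hk i (le_of_max_le_left hi) hij p hp) (hk' i (le_of_max_le_right hi) hij p hp)
      zero_mem' := fun m => ⟨0, fun i _ _ p _ => zero_mem _⟩
      smul_mem' := by
        intro r g hg m
        obtain ⟨k, hk⟩ := hg (m + r.unop.order.natAbs)
        refine ⟨k, fun i hi hij p hp => ?_⟩
        refine LaurentSeries.coeff_mul_mem (B i).toAddSubgroup g r.unop p fun u v huv => ?_
        by_cases hv : v < r.unop.order
        · rw [HahnSeries.coeff_eq_zero_of_lt_order hv, mul_zero]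
          exact zero_mem _
        · have := neg_abs_le r.unop.order
          exact (B i).smul_mem (MulOpposite.op _) (hk i hi hij u (by push_cast; omega)) }
  have hmem : ∀ j ≤ n, ∀ l ≤ n, l ≠ j → f l ∈ L j := by
    refine fun j hj l hl hlj m => ⟨m, fun i hi hij p hp => ?_⟩
    rw [hf]
    by_cases hp' : p = ((p.toNat.sqrt : ℤ)) ^ 2 ∧ p.toNat.sqrt % (n + 1) = l
    · simp only [c, if_pos hp']
      obtain ⟨h1, h2⟩ := hp'
      generalize p.toNat.sqrt = q at *
      have hqi : q < i := by
        refine lt_of_le_of_ne ?_ (by rintro rfl; exact hlj (h2.symm.trans hij))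
        by_contra! hlt
        have : ((i : ℤ) + 1) ^ 2 ≤ (q : ℤ) ^ 2 := by gcongr; exact_mod_cast hlt
        have hi' : (m : ℤ) ≤ i := by exact_mod_cast hi
        nlinarith
      exact hB.monotone hqi (ha q)
    · simp only [c, if_neg hp', zero_mem]
  obtain ⟨j, hj, hfj⟩ := hn f L hmem
  obtain ⟨k, hk⟩ := hfj 0
  have hmod : (k * (n + 1) + j) % (n + 1) = j := by
    rw [Nat.mul_add_mod', Nat.mod_eq_of_lt (by omega)]
  have := hk (k * (n + 1) + j) (by nlinarith) hmod (((k * (n + 1) + j : ℕ) : ℤ) ^ 2) (by simp)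
  rw [hfsq j _ hmod] at this
  exact ha' _ this

theorem LaurentSeries.exists_inverse_of_single_sub_single (A : Type*) [Ring A] {k l : ℕ}
    (hkl : k < l) : ∃ w : LaurentSeries A,
      (HahnSeries.single (k : ℤ) 1 - HahnSeries.single (l : ℤ) 1) * w = 1 := by
  have hd : (0 : ℤ) < l - k := by omega
  let c : ℤ → A := fun p => if 0 ≤ p + k ∧ ((l : ℤ) - k) ∣ p + k then 1 else 0
  have hc : BddBelow (Function.support c) := ⟨-k, fun p hp => by
    by_contra hneg
    exact hp (if_neg fun h => hneg (by omega))⟩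
  have hcoeff : ∀ p, (HahnSeries.ofSuppBddBelow c hc).coeff p = c p := fun p => rfl
  refine ⟨HahnSeries.ofSuppBddBelow c hc, ?_⟩
  ext p
  rw [sub_mul, HahnSeries.coeff_sub, HahnSeries.coeff_single_mul, HahnSeries.coeff_single_mul,
    hcoeff, hcoeff, HahnSeries.coeff_one]
  have e1 : p - k + k = p := by ring
  have e2 : p - l + k = p - (l - k) := by ring
  simp only [c, e1, e2, one_mul, dvd_sub_self_right]
  by_cases hdvd : (l : ℤ) - k ∣ p
  · obtain ⟨q, rfl⟩ := hdvd
    rcases lt_trichotomy q 0 with hq | rfl | hq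
    · rw [if_neg (by rintro ⟨h, -⟩; nlinarith), if_neg (by rintro ⟨h, -⟩; nlinarith),
        if_neg (by nlinarith), sub_zero]
    · simp [hkl]
    · rw [if_pos ⟨by positivity, by simp⟩, if_pos ⟨by nlinarith, by simp⟩,
        if_neg (by positivity), sub_self]
  · rw [if_neg (by tauto), if_neg (by tauto), if_neg (by rintro rfl; simp at hdvd), sub_zero]

theorem LaurentSeries.single_one_mul_comm {A : Type*} [Ring A] (k : ℤ) (g : LaurentSeries A) :
    HahnSeries.single k 1 * g = g * HahnSeries.single k 1 := by
  ext p
  rw [HahnSeries.coeff_single_mul, HahnSeries.coeff_mul_single, one_mul, mul_one]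

/-- Over a right serial ring, one of finitely many commuting elements that differ by central units
has to be right invertible. -/
theorem exists_mul_eq_one_of_laurentSeries {A : Type*} [Ring A]
    (h : IsRightSerialRing (LaurentSeries A)) (a : A) :
    ∃ (k : ℕ) (g : LaurentSeries A), 0 < k ∧
      (HahnSeries.single 0 a - HahnSeries.single (k : ℤ) 1) * g = 1 := by
  obtain ⟨n, hn⟩ := h.exists_bound
  let D : ℕ → LaurentSeries A := fun k =>
    HahnSeries.single 0 a - HahnSeries.single ((k + 1 : ℕ) : ℤ) 1
  let L : ℕ → Submodule (LaurentSeries A)ᵐᵒᵖ (LaurentSeries A) := fun k =>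
    LinearMap.range (LinearMap.mulLeft (LaurentSeries A)ᵐᵒᵖ (D k))
  have hL : ∀ k g, g ∈ L k ↔ ∃ r, D k * r = g := fun k g => Iff.rfl
  have hsub : ∀ j k, D j - D k = HahnSeries.single ((k + 1 : ℕ) : ℤ) 1 -
      HahnSeries.single ((j + 1 : ℕ) : ℤ) 1 := fun j k => by simp only [D]; abel
  have hcentral : ∀ j k g, (D j - D k) * g = g * (D j - D k) := fun j k g => by
    rw [hsub, sub_mul, mul_sub, LaurentSeries.single_one_mul_comm,
      LaurentSeries.single_one_mul_comm]
  have hcomm : ∀ j k, D j * D k = D k * D j := fun j k => by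
    have := hcentral j k (D k)
    rw [sub_mul (D j) (D k) (D k), mul_sub (D k) (D j) (D k)] at this
    exact sub_left_injective this
  have hinv : ∀ j k, j ≠ k → ∃ w, (D j - D k) * w = 1 := by
    intro j k hjk
    rcases lt_or_gt_of_ne hjk with hlt | hlt
    · obtain ⟨w, hw⟩ := LaurentSeries.exists_inverse_of_single_sub_single A
        (Nat.succ_lt_succ hlt)
      refine ⟨-w, ?_⟩
      rw [← hw, hsub, mul_neg, ← neg_mul, neg_sub]
    · obtain ⟨w, hw⟩ := LaurentSeries.exists_inverse_of_single_sub_single A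
        (Nat.succ_lt_succ hlt)
      exact ⟨w, by rw [hsub]; exact hw⟩
  have hprod_mem : ∀ (l : List ℕ) (k : ℕ), k ∈ l → (l.map D).prod ∈ L k := by
    intro l k hk
    induction l with
    | nil => simp at hk
    | cons i l ih =>
      rw [List.map_cons, List.prod_cons]
      rcases List.mem_cons.1 hk with rfl | hk
      · exact ⟨_, rfl⟩
      · obtain ⟨r, hr⟩ := (hL _ _).1 (ih hk)
        exact (hL _ _).2 ⟨D i * r, by rw [← hr, ← mul_assoc, ← mul_assoc, hcomm]⟩
  have hprod_one : ∀ (l : List ℕ) (k : ℕ), k ∉ l → (l.map D).prod ∈ L k → 1 ∈ L k := by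
    intro l k hk hmem
    induction l with
    | nil => simpa using hmem
    | cons i l ih =>
      rw [List.map_cons, List.prod_cons] at hmem
      rw [List.mem_cons, not_or] at hk
      refine ih hk.2 ?_
      obtain ⟨w, hw⟩ := hinv i k (Ne.symm hk.1)
      have h1 : (D i - D k) * (l.map D).prod ∈ L k := by
        rw [sub_mul]
        exact sub_mem hmem ⟨_, rfl⟩
      have h2 := (L k).smul_mem (MulOpposite.op w) h1
      rwa [MulOpposite.smul_eq_mul_unop, MulOpposite.unop_op, hcentral, mul_assoc, hw,
        mul_one] at h2
  obtain ⟨j, -, hj⟩ := hn (fun k => (((List.range (n + 1)).erase k).map D).prod) L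
    fun j hj l _ hlj => hprod_mem _ _
      ((List.mem_erase_of_ne hlj.symm).2 (List.mem_range.2 (Nat.lt_succ_of_le hj)))
  obtain ⟨g, hg⟩ := (hL _ _).1 (hprod_one _ _ List.nodup_range.not_mem_erase hj)
  exact ⟨j + 1, g, j.succ_pos, hg⟩

theorem exists_pow_eq_pow_succ_mul_of_laurentSeries {A : Type*} [Ring A]
    (h : IsRightSerialRing (LaurentSeries A)) (a : A) :
    ∃ (m : ℕ) (b : A), a ^ m = a ^ (m + 1) * b := by
  obtain ⟨k, g, hk, hg⟩ := exists_mul_eq_one_of_laurentSeries h a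
  have hcoeff : ∀ p : ℤ, a * g.coeff p = g.coeff (p - k) + (if p = 0 then 1 else 0) := by
    intro p
    have := congrArg (fun f : LaurentSeries A => f.coeff p) hg
    simp only [sub_mul, HahnSeries.coeff_sub, HahnSeries.coeff_single_mul, HahnSeries.coeff_one,
      sub_zero, one_mul] at this
    rw [← sub_eq_iff_eq_add']
    convert this
  have hpow : ∀ i : ℕ, g.coeff (-((i + 1 : ℕ) * k : ℤ)) = a ^ i * (a * g.coeff 0 - 1) := by
    intro i
    induction i with
    | zero =>
      have := hcoeff 0
      rw [if_pos rfl] at this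
      rw [this]; simp
    | succ i ih =>
      have := hcoeff (-((i + 1 : ℕ) * k : ℤ))
      rw [if_neg (by push_cast; intro h0; nlinarith), add_zero] at this
      rw [pow_succ', mul_assoc, ← ih, this]
      congr 1
      push_cast; ring
  refine ⟨g.order.natAbs, g.coeff 0, ?_⟩
  have h0 : g.coeff (-((g.order.natAbs + 1 : ℕ) * k : ℤ)) = 0 := by
    refine HahnSeries.coeff_eq_zero_of_lt_order ?_
    have := neg_abs_le g.order
    have hk' : (1 : ℤ) ≤ k := by exact_mod_cast hk
    have := abs_nonneg g.order
    push_cast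
    nlinarith
  rw [hpow, mul_sub, mul_one, ← mul_assoc, ← pow_succ, sub_eq_zero] at h0
  exact h0.symm

/-- Fitting's lemma for a single endomorphism of a Noetherian module whose powers have images that
stop decreasing at some point. -/
theorem exists_isCompl_ker_range_pow {R M : Type*} [Ring R] [AddCommGroup M] [Module R M]
    [IsNoetherian R M] (φ : Module.End R M) {m : ℕ}
    (h : LinearMap.range (φ ^ m) ≤ LinearMap.range (φ ^ (m + 1))) :
    ∃ n, 0 < n ∧ IsCompl (LinearMap.ker (φ ^ n)) (LinearMap.range (φ ^ n)) := by
  have hstep : ∀ i, LinearMap.range (φ ^ m) ≤ LinearMap.range (φ ^ (m + i)) := by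
    intro i
    induction i with
    | zero => rfl
    | succ i ih =>
      refine h.trans ?_
      rintro _ ⟨x, rfl⟩
      obtain ⟨y, hy⟩ := ih ⟨x, rfl⟩
      refine ⟨y, ?_⟩
      rw [← add_assoc, pow_succ', Module.End.mul_apply, hy, ← Module.End.mul_apply, ← pow_succ']
  obtain ⟨N, hN⟩ := Filter.eventually_atTop.1 φ.eventually_disjoint_ker_pow_range_pow
  refine ⟨max N m + 1, Nat.succ_pos _, hN _ (by omega), codisjoint_iff.2 (eq_top_iff.2 ?_)⟩
  intro x _
  set n := max N m + 1
  have hn : m ≤ n := by omega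
  have hx : (φ ^ n) x ∈ LinearMap.range (φ ^ (n + n)) := by
    have h1 : (φ ^ n) x ∈ LinearMap.range (φ ^ m) :=
      ⟨(φ ^ (n - m)) x, by rw [← Module.End.mul_apply, ← pow_add, Nat.add_sub_cancel' hn]⟩
    have h2 := hstep (n + n - m) h1
    rwa [Nat.add_sub_cancel' (by omega)] at h2
  obtain ⟨y, hy⟩ := hx
  refine Submodule.mem_sup.2 ⟨x - (φ ^ n) y, ?_, (φ ^ n) y, ⟨y, rfl⟩, sub_add_cancel _ _⟩
  rw [LinearMap.mem_ker, map_sub, ← hy, pow_add, Module.End.mul_apply, sub_self]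

theorem complementedLattice_of_exists_isComplemented_le {α : Type*} [Lattice α] [BoundedOrder α]
    [IsModularLattice α] [WellFoundedGT α]
    (h : ∀ b : α, b ≠ ⊥ → ∃ c, c ≠ ⊥ ∧ c ≤ b ∧ IsComplemented c) : ComplementedLattice α := by
  refine ⟨fun b => ?_⟩
  obtain ⟨c, ⟨hcb, d, hd⟩, hmax⟩ := (wellFounded_gt (α := α)).has_min
    {c | c ≤ b ∧ IsComplemented c} ⟨⊥, bot_le, isComplemented_bot⟩
  have hbd : b ⊓ d = ⊥ := by
    by_contra hne
    obtain ⟨e, he, hele, e', hee'⟩ := h _ hne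
    have hed : e ≤ d := hele.trans inf_le_right
    refine hmax (c ⊔ e) ⟨sup_le hcb (hele.trans inf_le_left), d ⊓ e', ?_, ?_⟩ ?_
    · rw [disjoint_iff, ← inf_assoc, sup_comm, sup_inf_assoc_of_le c hed, hd.inf_eq_bot,
        sup_bot_eq, hee'.inf_eq_bot]
    · rw [codisjoint_iff, sup_assoc, inf_comm, ← sup_inf_assoc_of_le e' hed,
        hee'.sup_eq_top, top_inf_eq, hd.sup_eq_top]
    · refine lt_of_le_of_ne le_sup_left fun heq => he ?_
      have hec : e ≤ c := heq ▸ le_sup_right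
      exact le_bot_iff.1 (hd.inf_eq_bot ▸ le_inf hec hed)
  have hbc : b = c := by
    have := sup_inf_assoc_of_le d hcb
    rw [hd.sup_eq_top, top_inf_eq, inf_comm, hbd, sup_bot_eq] at this
    exact this
  exact ⟨d, hbc ▸ hd⟩

theorem exists_mul_not_isNilpotent {S : Type*} [Ring S] {x : S} (hx : x ∉ Ring.jacobson S) :
    ∃ s, ¬ IsNilpotent (s * x) := by
  by_contra! hnil
  refine hx ?_
  rw [← Ideal.jacobson_bot, Ideal.mem_jacobson_iff]
  intro y
  obtain ⟨u, hu⟩ := (hnil y).isUnit_one_add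
  refine ⟨↑u⁻¹, ?_⟩
  have : (↑u⁻¹ : S) * y * x + ↑u⁻¹ - 1 = ↑u⁻¹ * (1 + y * x) - 1 := by
    rw [mul_add, mul_assoc, mul_one, add_comm]
  rw [this, ← hu, Units.inv_mul, sub_self]
  exact zero_mem _

/-- Levitzki's theorem for two-sided ideals. -/
theorem isNilpotent_of_forall_isNilpotent {S : Type*} [Ring S] [IsNoetherianRing S] (N : Ideal S)
    [N.IsTwoSided] (hN : ∀ x ∈ N, IsNilpotent x) : IsNilpotent N := by
  obtain ⟨I, ⟨hIN, hItwo, hInil⟩, hmax⟩ := (wellFounded_gt (α := Ideal S)).has_min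
    {I | I ≤ N ∧ I.IsTwoSided ∧ IsNilpotent I} ⟨⊥, bot_le, inferInstance, 1, by simp⟩
  by_contra hnot
  obtain ⟨a₀, ha₀, ha₀I⟩ := SetLike.not_le_iff_exists.1 fun hle => hnot (le_antisymm hle hIN ▸ hInil)
  let ann : S → Ideal S := fun a => Submodule.comap (LinearMap.toSpanSingleton S S a) I
  have hann : ∀ a s, s ∈ ann a ↔ s * a ∈ I := fun a s => Iff.rfl
  obtain ⟨_, ⟨a, ⟨haN, haI⟩, rfl⟩, hamax⟩ := (wellFounded_gt (α := Ideal S)).has_min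
    (ann '' {a | a ∈ N ∧ a ∉ I}) ⟨_, a₀, ⟨ha₀, ha₀I⟩, rfl⟩
  have haa : ∀ s, a * s * a ∈ I := by
    intro s
    have hex : ∃ k, (a * s) ^ k ∈ I := by
      obtain ⟨k, hk⟩ := hN _ (N.mul_mem_right s haN)
      exact ⟨k, by rw [hk]; exact zero_mem _⟩
    classical
    obtain ⟨k, hk⟩ : ∃ k, Nat.find hex = k := ⟨_, rfl⟩
    have hkI : (a * s) ^ k ∈ I := hk ▸ Nat.find_spec hex
    match k with
    | 0 => exact absurd (by simpa using I.mul_mem_left a hkI) haI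
    | 1 => exact I.mul_mem_right _ (by simpa using hkI)
    | k + 2 =>
      have hb : (a * s) ^ (k + 1) ∉ I := Nat.find_min hex (by omega)
      have hbN : (a * s) ^ (k + 1) ∈ N := by
        rw [pow_succ, ← mul_assoc]
        exact N.mul_mem_right _ (N.mul_mem_left _ haN)
      have hle : ann a ≤ ann ((a * s) ^ (k + 1)) := by
        intro r hr
        rw [hann] at hr ⊢
        rw [pow_succ', ← mul_assoc, ← mul_assoc]
        exact I.mul_mem_right _ (I.mul_mem_right _ hr)
      have heq := eq_of_le_of_not_lt hle (hamax _ ⟨_, ⟨hbN, hb⟩, rfl⟩)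
      rw [← hann, heq, hann, ← pow_succ']
      exact hkI
  let J : Ideal S :=
    { carrier := {x | x ∈ N ∧ (∀ s, x * s * a ∈ I) ∧
        ∀ y ∈ N, (∀ s, y * s * a ∈ I) → ∀ s, y * s * x ∈ I}
      add_mem' := fun {x x'} hx hx' => ⟨add_mem hx.1 hx'.1,
        fun s => by rw [add_mul, add_mul]; exact add_mem (hx.2.1 s) (hx'.2.1 s),
        fun y hy hya s => by rw [mul_add]; exact add_mem (hx.2.2 y hy hya s) (hx'.2.2 y hy hya s)⟩
      zero_mem' := ⟨zero_mem _, fun s => by simp, fun y _ _ s => by simp⟩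
      smul_mem' := fun r x hx => ⟨N.mul_mem_left r hx.1,
        fun s => by
          rw [smul_eq_mul, mul_assoc, mul_assoc, ← mul_assoc x]; exact I.mul_mem_left r (hx.2.1 s),
        fun y hy hya s => by
          rw [smul_eq_mul, ← mul_assoc, mul_assoc y]; exact hx.2.2 y hy hya (s * r)⟩ }
  have hJtwo : J.IsTwoSided := ⟨fun {x} r hx => ⟨N.mul_mem_right r hx.1,
    fun s => by rw [mul_assoc x]; exact hx.2.1 (r * s),
    fun y hy hya s => by rw [← mul_assoc]; exact I.mul_mem_right r (hx.2.2 y hy hya s)⟩⟩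
  have hIJ : I ≤ J := fun x hx => ⟨hIN hx, fun s => I.mul_mem_right _ (I.mul_mem_right _ hx),
    fun y _ _ s => I.mul_mem_left _ hx⟩
  have hJJ : J * J ≤ I := Ideal.mul_le.2 fun x hx y hy => by
    simpa using hy.2.2 x hx.1 hx.2.1 1
  obtain ⟨k, hk⟩ := hInil
  refine hmax J ⟨fun x hx => hx.1, hJtwo, 2 * k, ?_⟩
    (lt_of_le_of_ne hIJ fun heq => haI ?_)
  · have hpow : ∀ k, J ^ (2 * k) ≤ I ^ k := by
      intro k
      induction k with
      | zero => rfl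
      | succ k ih =>
        rw [Nat.mul_succ, Submodule.pow_succ, Submodule.pow_succ, Submodule.pow_succ,
          Ideal.mul_assoc]
        exact Ideal.mul_mono ih hJJ
    exact le_bot_iff.1 ((hpow k).trans hk.le)
  · rw [heq]
    exact ⟨haN, haa, fun y _ hya s => hya s⟩

theorem isSemisimpleRing_of_exists_pow_eq {S : Type*} [Ring S] [IsNoetherianRing S]
    (hjac : Ring.jacobson S = ⊥) (h : ∀ a : S, ∃ (m : ℕ) (b : S), a ^ m = b * a ^ (m + 1)) :
    IsSemisimpleRing S := by
  have : ComplementedLattice (Ideal S) := by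
    refine complementedLattice_of_exists_isComplemented_le fun B hB => ?_
    obtain ⟨x, hxB, hx0⟩ := B.exists_mem_ne_zero_of_ne_bot hB
    obtain ⟨s, hs⟩ := exists_mul_not_isNilpotent (x := x) (by rw [hjac]; exact hx0)
    obtain ⟨m, b, hb⟩ := h (s * x)
    let φ : Module.End S S := LinearMap.toSpanSingleton S S (s * x)
    have hφ : ∀ (n : ℕ) (r : S), (φ ^ n) r = r * (s * x) ^ n := by
      intro n
      induction n with
      | zero => simp
      | succ n ih =>
        intro r
        rw [pow_succ', Module.End.mul_apply, ih, pow_succ, ← mul_assoc]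
        rfl
    obtain ⟨n, hn, hcompl⟩ := exists_isCompl_ker_range_pow φ (m := m) (by
      rintro _ ⟨r, rfl⟩
      exact ⟨r * b, by rw [hφ, hφ, hb, mul_assoc]⟩)
    refine ⟨LinearMap.range (φ ^ n), ?_, ?_, _, hcompl.symm⟩
    · intro hbot
      refine hs ⟨n, ?_⟩
      have : (φ ^ n) 1 ∈ (⊥ : Submodule S S) := hbot ▸ ⟨1, rfl⟩
      rwa [hφ, one_mul, Submodule.mem_bot] at this
    · rintro _ ⟨r, rfl⟩
      obtain ⟨k, rfl⟩ := Nat.exists_eq_succ_of_ne_zero hn.ne'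
      rw [hφ, Nat.succ_eq_add_one, pow_succ, ← mul_assoc, ← mul_assoc]
      exact B.mul_mem_left _ hxB
  exact (isSemisimpleModule_iff _ _).2 this

/-- A left Noetherian ring in which every descending chain of powers of a principal left ideal
stabilizes is semiprimary. -/
theorem isSemiprimaryRing_of_exists_pow_eq {S : Type*} [Ring S] [IsNoetherianRing S]
    (h : ∀ a : S, ∃ (m : ℕ) (b : S), a ^ m = b * a ^ (m + 1)) : IsSemiprimaryRing S := by
  refine ⟨?_, isNilpotent_of_forall_isNilpotent _ fun x hx => ?_⟩
  · have hsurj := Ideal.Quotient.mk_surjective (I := Ring.jacobson S)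
    have := isNoetherianRing_of_surjective _ _ (Ideal.Quotient.mk (Ring.jacobson S)) hsurj
    refine isSemisimpleRing_of_exists_pow_eq (Ring.jacobson_quotient_jacobson S) fun a => ?_
    obtain ⟨c, rfl⟩ := hsurj a
    obtain ⟨m, b, hb⟩ := h c
    exact ⟨m, Ideal.Quotient.mk _ b, by rw [← map_pow, hb, map_mul, map_pow]⟩
  · obtain ⟨m, b, hb⟩ := h x
    refine ⟨m, ?_⟩
    rw [← Ideal.jacobson_bot, Ideal.mem_jacobson_iff] at hx
    obtain ⟨z, hz⟩ := hx (-b)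
    have h1 : (1 - b * x) * x ^ m = 0 := by
      rw [sub_mul, one_mul, mul_assoc, ← pow_succ', ← hb, sub_self]
    have h2 : z * (1 - b * x) = 1 := by
      rw [Submodule.mem_bot, sub_eq_zero] at hz
      rw [mul_neg, neg_mul, mul_assoc, neg_add_eq_sub] at hz
      rw [mul_sub, mul_one, hz]
    rw [← one_mul (x ^ m), ← h2, mul_assoc, h1, mul_zero]

theorem IsIdempotentElem.eq_zero_of_mem_of_isNilpotent {S : Type*} [Ring S] {J : Ideal S}
    [J.IsTwoSided] (hJ : IsNilpotent J) {e : S} (he : IsIdempotentElem e) (hmem : e ∈ J) :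
    e = 0 := by
  obtain ⟨k, hk⟩ := hJ
  have h1 : e ^ (k + 1) ∈ J ^ k :=
    Ideal.pow_le_pow_right (Nat.le_succ k) (Ideal.pow_mem_pow hmem (k + 1))
  rw [he.pow_succ_eq, hk] at h1
  simpa using h1

open MulOpposite in
/-- Cancellation of a Laurent series one of whose coefficients is invertible relative to `e`, all
other coefficients being so or lying in a nilpotent ideal. -/
theorem LaurentSeries.eq_zero_of_mul_eq_zero {A : Type*} [Ring A] {J : Ideal Aᵐᵒᵖ}
    [J.IsTwoSided] (hJ : IsNilpotent J) {e : A} {f r : LaurentSeries A}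
    (hf : ∀ p, op (f.coeff p) ∈ J ∨ ∃ c, c * f.coeff p = e) (hf' : ∃ p, op (f.coeff p) ∉ J)
    (hr : ∀ p, e * r.coeff p = r.coeff p) (hfr : f * r = 0) : r = 0 := by
  have hleast : ∀ (I : Ideal Aᵐᵒᵖ) (g : LaurentSeries A), (∃ p, op (g.coeff p) ∉ I) →
      ∃ p, op (g.coeff p) ∉ I ∧ ∀ i, op (g.coeff i) ∉ I → p ≤ i := fun I g hg => by
    refine Int.exists_least_of_bdd ⟨g.order, fun i hi => ?_⟩ hg
    by_contra! hlt
    rw [HahnSeries.coeff_eq_zero_of_lt_order hlt] at hi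
    exact hi (zero_mem I)
  obtain ⟨p, hp, hpmin⟩ := hleast J f hf'
  have key : ∀ k q, op (r.coeff q) ∈ J ^ k := by
    intro k
    induction k with
    | zero => intro q; rw [Submodule.pow_zero, Ideal.one_eq_top]; trivial
    | succ k ih =>
      by_contra! hex
      obtain ⟨q, hq, hqmin⟩ := hleast _ r hex
      refine hq ?_
      have h1 : op ((f * (r - HahnSeries.single q (r.coeff q))).coeff (p + q)) ∈ J ^ (k + 1) := by
        refine LaurentSeries.coeff_mul_mem
          ((J ^ (k + 1)).toAddSubgroup.comap (opAddEquiv (α := A)).toAddMonoidHom) _ _ _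
          fun i j hij => ?_
        change op (f.coeff i * _) ∈ J ^ (k + 1)
        rw [op_mul, HahnSeries.coeff_sub]
        by_cases hj : j = q
        · subst hj
          simp
        rw [HahnSeries.coeff_single_of_ne hj, sub_zero]
        by_cases hjq : j < q
        · refine Ideal.mul_mem_right _ _ ?_
          by_contra hj'
          exact absurd (hqmin j hj') (by omega)
        · rw [Submodule.pow_succ]
          refine Ideal.mul_mem_mul (ih j) ?_
          by_contra hi
          exact absurd (hpmin i hi) (by omega)
      rw [mul_sub, hfr, zero_sub, HahnSeries.coeff_neg, HahnSeries.coeff_mul_single_add,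
        op_neg, neg_mem_iff] at h1
      obtain ⟨c, hc⟩ := (hf p).resolve_left hp
      rw [← hr, ← hc, mul_assoc, op_mul]
      exact Ideal.mul_mem_right _ _ h1
  obtain ⟨k, hk⟩ := hJ
  ext q
  simpa [hk] using key k q

open MulOpposite in
/-- Divisibility on the left is total on `e * A` if `e` is a local idempotent. -/
theorem exists_eq_mul_or_exists_eq_mul_of_laurentSeries {A : Type*} [Ring A]
    (h : IsRightSerialRing (LaurentSeries A)) {J : Ideal Aᵐᵒᵖ} [J.IsTwoSided]
    (hJ : IsNilpotent J) {e : A} (he : e * e = e) (he0 : e ≠ 0)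
    (hloc : ∀ c, e * c = c → c * e = c → op c ∈ J ∨ ∃ c', c' * c = e)
    {a b : A} (ha : e * a = a) (hb : e * b = b) : (∃ r, a = b * r) ∨ ∃ r, b = a * r := by
  classical
  obtain ⟨ι, _, K, -, hsup, hK⟩ := h
  let C : A → LaurentSeries A := HahnSeries.single 0
  have hCe : ∀ c, e * c = c → C e * C c = C c := fun c hc => by
    simp only [C, HahnSeries.single_mul_single, hc, add_zero]
  have heJ : op e ∉ J := by
    intro hmem
    have h2 : IsIdempotentElem (op e) := by
      rw [IsIdempotentElem, ← op_mul, he]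
    exact he0 (by simpa using h2.eq_zero_of_mem_of_isNilpotent hJ hmem)
  obtain ⟨u, hu⟩ : ∃ u : ι → LaurentSeries A, (∀ i, u i ∈ K i) ∧ ∑ i, u i = C e := by
    have : C e ∈ ⨆ i ∈ Finset.univ, K i := by simp [hsup]
    obtain ⟨u, hu⟩ := (Submodule.mem_iSup_finset_iff_exists_sum _ _).1 this
    exact ⟨fun i => u i, fun i => (u i).2, hu⟩
  obtain ⟨hu, hsum⟩ := hu
  have hcoeff : ∀ i p, (C e * u i * C e).coeff p = e * (u i).coeff p * e := fun i p => by
    simp only [C, HahnSeries.coeff_mul_single_zero, HahnSeries.coeff_single_zero_mul]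
  obtain ⟨i, p, hip⟩ : ∃ i p, op ((C e * u i * C e).coeff p) ∉ J := by
    by_contra! hall
    have h1 : ∑ i, C e * u i * C e = C e := by
      rw [← Finset.sum_mul, ← Finset.mul_sum, hsum, hCe e he, hCe e he]
    have h2 : ∑ i, (C e * u i * C e).coeff 0 = e := by
      rw [← HahnSeries.coeff_sum, h1]
      simp [C]
    refine heJ ?_
    rw [← h2, Finset.op_sum]
    exact sum_mem fun i _ => hall i 0
  have hcancel : ∀ s : LaurentSeries A, u i * s = 0 → C e * s = s → s = 0 := by
    intro s hs hes
    refine LaurentSeries.eq_zero_of_mul_eq_zero hJ (f := C e * u i * C e) (e := e)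
      (fun q => ?_) ⟨p, hip⟩ (fun q => ?_) ?_
    · rw [hcoeff]
      exact hloc _ (by simp only [← mul_assoc, he]) (by simp only [mul_assoc, he])
    · conv_rhs => rw [← hes]
      simp only [C, HahnSeries.coeff_single_zero_mul]
    · rw [mul_assoc, hes, mul_assoc, hs, mul_zero]
  have hdiv : ∀ a b, e * a = a → e * b = b → ∀ r, u i * C a = u i * C b * r → ∃ r, a = b * r := by
    intro a b ha hb r hr
    have h0 : C a - C b * r = 0 := by
      refine hcancel _ ?_ ?_
      · rw [mul_sub, hr, ← mul_assoc, sub_self]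
      · rw [mul_sub, ← mul_assoc, hCe a ha, hCe b hb]
    refine ⟨r.coeff 0, ?_⟩
    have := congrArg (fun s : LaurentSeries A => s.coeff 0) (sub_eq_zero.1 h0)
    simpa only [C, HahnSeries.coeff_single_zero_mul, HahnSeries.coeff_single_same] using this
  have hspan : ∀ c, Submodule.span (LaurentSeries A)ᵐᵒᵖ {u i * c} ≤ K i := fun c => by
    rw [Submodule.span_singleton_le_iff_mem]
    exact (K i).smul_mem (op c) (hu i)
  rcases (hK i).le_or_le (hspan (C a)) (hspan (C b)) with hle | hle
  · obtain ⟨r, hr⟩ := Submodule.mem_span_singleton.1 (hle (Submodule.mem_span_singleton_self _))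
    exact .inl (hdiv a b ha hb r.unop hr.symm)
  · obtain ⟨r, hr⟩ := Submodule.mem_span_singleton.1 (hle (Submodule.mem_span_singleton_self _))
    exact .inr (hdiv b a hb ha r.unop hr.symm)

open MulOpposite in
/-- The corner ring of an idempotent generating an indecomposable right ideal is local. -/
theorem exists_mul_eq_of_indecomposable {A : Type*} [Ring A] [IsNoetherian Aᵐᵒᵖ A]
    (h : ∀ a : A, ∃ (m : ℕ) (b : A), a ^ m = a ^ (m + 1) * b)
    {P : Submodule Aᵐᵒᵖ A} {e : A} (heP : ∀ x, x ∈ P ↔ e * x = x) (he : e * e = e)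
    (hP : ∀ X Y : Submodule Aᵐᵒᵖ A, X ⊔ Y = P → Disjoint X Y → X = ⊥ ∨ Y = ⊥)
    {c : A} (hec : e * c = c) (hce : c * e = c) (hc : op c ∉ Ring.jacobson Aᵐᵒᵖ) :
    ∃ y, e * y = y ∧ y * e = y ∧ c * y = e := by
  obtain ⟨s, hs⟩ := exists_mul_not_isNilpotent hc
  obtain ⟨a, rfl⟩ := op_surjective s
  rw [← op_mul] at hs
  obtain ⟨d, hd⟩ : ∃ d, d = c * a * e := ⟨_, rfl⟩
  have hed : ∀ n, 0 < n → e * d ^ n = d ^ n := fun n hn => by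
    obtain ⟨n, rfl⟩ := Nat.exists_eq_add_of_lt hn
    rw [pow_succ', ← mul_assoc, hd]
    simp only [← mul_assoc, hec]
  have hdpow : ∀ n, d ^ n * (c * a) = (c * a) ^ (n + 1) := fun n => by
    induction n with
    | zero => simp
    | succ n ih =>
      have hdc : d * (c * a) = c * a * (c * a) := by
        rw [hd, mul_assoc (c * a), ← mul_assoc e, hec]
      rw [pow_succ, mul_assoc, hdc, ← mul_assoc, ih, ← pow_succ]
  have hd0 : ∀ n, d ^ n ≠ 0 := fun n hn => hs ⟨n + 1, by
    rw [← op_pow, ← hdpow, hn, zero_mul, op_zero]⟩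
  have hrange : ∀ n x, x ∈ LinearMap.range (LinearMap.mulLeft Aᵐᵒᵖ d ^ n) ↔
      ∃ y, d ^ n * y = x := fun n x => by
    rw [LinearMap.pow_mulLeft]
    exact Iff.rfl
  obtain ⟨m, b, hmb⟩ := h d
  obtain ⟨n, hn, hcompl⟩ := exists_isCompl_ker_range_pow (LinearMap.mulLeft Aᵐᵒᵖ d) (m := m)
    fun x hx => by
      obtain ⟨y, rfl⟩ := (hrange _ _).1 hx
      exact (hrange _ _).2 ⟨b * y, by rw [hmb, mul_assoc]⟩
  have hle : LinearMap.range (LinearMap.mulLeft Aᵐᵒᵖ d ^ n) ≤ P := fun x hx => by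
    obtain ⟨y, rfl⟩ := (hrange _ _).1 hx
    rw [heP, ← mul_assoc, hed n hn]
  have heR : e ∈ LinearMap.range (LinearMap.mulLeft Aᵐᵒᵖ d ^ n) := by
    rcases hP (LinearMap.range (LinearMap.mulLeft Aᵐᵒᵖ d ^ n))
      (LinearMap.ker (LinearMap.mulLeft Aᵐᵒᵖ d ^ n) ⊓ P)
      (by rw [← sup_inf_assoc_of_le _ hle, sup_comm, hcompl.sup_eq_top, top_inf_eq])
      (hcompl.symm.disjoint.mono_right inf_le_left) with h0 | h0
    · have h1 : d ^ n ∈ LinearMap.range (LinearMap.mulLeft Aᵐᵒᵖ d ^ n) :=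
        (hrange _ _).2 ⟨1, mul_one _⟩
      rw [h0] at h1
      exact absurd ((Submodule.mem_bot _).1 h1) (hd0 n)
    · have hPR := sup_inf_assoc_of_le (LinearMap.ker (LinearMap.mulLeft Aᵐᵒᵖ d ^ n)) hle
      rw [h0, sup_bot_eq, sup_comm, hcompl.sup_eq_top, top_inf_eq] at hPR
      rw [← hPR, heP, he]
  obtain ⟨y, hy⟩ := (hrange _ _).1 heR
  obtain ⟨n, rfl⟩ := Nat.exists_eq_add_of_lt hn
  refine ⟨e * (a * e * d ^ (0 + n) * y) * e, ?_, ?_, ?_⟩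
  · simp only [← mul_assoc, he]
  · simp only [mul_assoc, he]
  · calc c * (e * (a * e * d ^ (0 + n) * y) * e)
        = c * e * a * e * d ^ (0 + n) * y * e := by simp only [mul_assoc]
      _ = d ^ (0 + n + 1) * y * e := by rw [hce, ← hd, ← pow_succ']
      _ = e := by rw [hy, he]

open MulOpposite in
/-- An indecomposable direct summand of `A` is uniserial. -/
theorem isUniserialModule_of_indecomposable {A : Type*} [Ring A] [IsNoetherian Aᵐᵒᵖ A]
    (h : IsRightSerialRing (LaurentSeries A)) (hJ : IsNilpotent (Ring.jacobson Aᵐᵒᵖ))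
    {P : Submodule Aᵐᵒᵖ A} (hcompl : IsComplemented P) (hbot : P ≠ ⊥)
    (hP : ∀ X Y : Submodule Aᵐᵒᵖ A, X ⊔ Y = P → Disjoint X Y → X = ⊥ ∨ Y = ⊥) :
    IsUniserialModule Aᵐᵒᵖ P := by
  obtain ⟨Q, hPQ⟩ := hcompl
  obtain ⟨e, heP', q, hq, heq⟩ : ∃ e ∈ P, ∃ q ∈ Q, e + q = 1 :=
    Submodule.mem_sup.1 (hPQ.sup_eq_top ▸ Submodule.mem_top)
  have hmul : ∀ (B : Submodule Aᵐᵒᵖ A) x y, x ∈ B → x * y ∈ B := fun B x y hx =>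
    B.smul_mem (op y) hx
  have heP : ∀ x, x ∈ P ↔ e * x = x := by
    refine fun x => ⟨fun hx => ?_, fun hx => hx ▸ hmul P e x heP'⟩
    have h1 : x - e * x = q * x := by
      rw [sub_eq_iff_eq_add', ← add_mul, heq, one_mul]
    have h2 : x - e * x ∈ P ⊓ Q :=
      ⟨sub_mem hx (hmul P e x heP'), h1 ▸ hmul Q q x hq⟩
    rw [hPQ.inf_eq_bot, Submodule.mem_bot, sub_eq_zero] at h2
    exact h2.symm
  have he : e * e = e := (heP e).1 heP'
  have he0 : e ≠ 0 := by
    rintro rfl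
    refine hbot ((Submodule.eq_bot_iff _).2 fun x hx => ?_)
    rw [← (heP x).1 hx, zero_mul]
  have hinv := fun c => exists_mul_eq_of_indecomposable (c := c)
    (exists_pow_eq_pow_succ_mul_of_laurentSeries h) heP he hP
  have hloc : ∀ c, e * c = c → c * e = c → op c ∈ Ring.jacobson Aᵐᵒᵖ ∨ ∃ c', c' * c = e := by
    intro c hec hce
    by_cases hc : op c ∈ Ring.jacobson Aᵐᵒᵖ
    · exact .inl hc
    obtain ⟨y, hey, hye, hcy⟩ := hinv c hec hce hc
    obtain ⟨z, hez, -, hyz⟩ := hinv y hey hye fun hy => he0 <| by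
      have h1 : IsIdempotentElem (op e) := by rw [IsIdempotentElem, ← op_mul, he]
      have h2 : op e ∈ Ring.jacobson Aᵐᵒᵖ := by
        rw [← hcy, op_mul]
        exact Ideal.mul_mem_right _ _ hy
      simpa using h1.eq_zero_of_mem_of_isNilpotent hJ h2
    refine .inr ⟨y, ?_⟩
    rw [← hce, ← hyz, ← mul_assoc c, hcy, hez]
  intro X Y
  by_contra! hXY
  obtain ⟨⟨a, haX, haY⟩, ⟨b, hbY, hbX⟩⟩ := And.imp SetLike.not_le_iff_exists.1
    SetLike.not_le_iff_exists.1 hXY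
  rcases exists_eq_mul_or_exists_eq_mul_of_laurentSeries h hJ he he0 hloc ((heP _).1 a.2)
    ((heP _).1 b.2) with ⟨r, hr⟩ | ⟨r, hr⟩
  · exact haY ((Subtype.ext hr : a = op r • b) ▸ Y.smul_mem _ hbY)
  · exact hbX ((Subtype.ext hr : b = op r • a) ▸ X.smul_mem _ haX)

theorem iSupIndep.sumElim {α ι κ : Type*} [CompleteLattice α] [IsModularLattice α] {s : ι → α}
    {t : κ → α} (hs : iSupIndep s) (ht : iSupIndep t) (hst : Disjoint (⨆ i, s i) (⨆ j, t j)) :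
    iSupIndep (Sum.elim s t) := by
  rintro (i | j)
  · have h1 : Disjoint (s i) ((⨆ (k) (_ : k ≠ i), s k) ⊔ ⨆ j, t j) :=
      (hs i).disjoint_sup_right_of_disjoint_sup_left
        (hst.mono_left (sup_le (le_iSup s i) (iSup₂_le fun k _ => le_iSup s k)))
    refine h1.mono_right (iSup₂_le ?_)
    rintro (k | k) hk
    · exact le_sup_of_le_left (le_iSup₂_of_le k (fun h => hk (h ▸ rfl)) le_rfl)
    · exact le_sup_of_le_right (le_iSup t k)
  · have h1 : Disjoint (t j) ((⨆ (k) (_ : k ≠ j), t k) ⊔ ⨆ i, s i) :=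
      (ht j).disjoint_sup_right_of_disjoint_sup_left
        (hst.symm.mono_left (sup_le (le_iSup t j) (iSup₂_le fun k _ => le_iSup t k)))
    refine h1.mono_right (iSup₂_le ?_)
    rintro (k | k) hk
    · exact le_sup_of_le_right (le_iSup s k)
    · exact le_sup_of_le_left (le_iSup₂_of_le k (fun h => hk (h ▸ rfl)) le_rfl)

/-- If the indecomposable direct summands of an Artinian module are uniserial, then all its direct
summands are serial. -/
theorem exists_iSupIndep_isUniserialModule {R M : Type*} [Ring R] [AddCommGroup M] [Module R M]
    [IsArtinian R M]
    (h : ∀ P : Submodule R M, IsComplemented P → P ≠ ⊥ →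
      (∀ X Y : Submodule R M, X ⊔ Y = P → Disjoint X Y → X = ⊥ ∨ Y = ⊥) → IsUniserialModule R P)
    (P : Submodule R M) (hP : IsComplemented P) :
    ∃ (ι : Type) (_ : Fintype ι) (N : ι → Submodule R M),
      iSupIndep N ∧ ⨆ i, N i = P ∧ ∀ i, IsUniserialModule R (N i) := by
  induction P using WellFoundedLT.induction with
  | ind P ih =>
  by_cases hbot : P = ⊥
  · exact ⟨Empty, inferInstance, fun _ => ⊥, fun i => i.elim, by simp [hbot], fun i => i.elim⟩
  by_cases hind : ∀ X Y : Submodule R M, X ⊔ Y = P → Disjoint X Y → X = ⊥ ∨ Y = ⊥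
  · refine ⟨Unit, inferInstance, fun _ => P, ?_, by simp, fun _ => h P hP hbot hind⟩
    exact iSupIndep_subsingleton _
  push Not at hind
  obtain ⟨X, Y, rfl, hXY, hX, hY⟩ := hind
  obtain ⟨Q, hQ⟩ := hP
  obtain ⟨ι, _, N, hN, hNX, hNu⟩ := ih X
    (left_lt_sup.2 fun hle => hY (hXY.symm.eq_bot_of_le hle))
    ⟨Y ⊔ Q, hXY.isCompl_sup_right_of_isCompl_sup_left hQ⟩
  obtain ⟨κ, _, L, hL, hLY, hLu⟩ := ih Y
    (right_lt_sup.2 fun hle => hX (hXY.eq_bot_of_le hle))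
    ⟨X ⊔ Q, hXY.symm.isCompl_sup_right_of_isCompl_sup_left (sup_comm X Y ▸ hQ)⟩
  refine ⟨ι ⊕ κ, inferInstance, Sum.elim N L, ?_, ?_, ?_⟩
  · exact hN.sumElim hL (by rwa [hNX, hLY])
  · rw [iSup_sum, ← hNX, ← hLY]; rfl
  · rintro (i | i)
    exacts [hNu i, hLu i]

/-- If the Laurent series ring `A((x))` is a right serial ring, then `A` is a
right serial right Artinian ring. -/
theorem rightSerial_of_laurentSeries_rightSerial (A : Type*) [Ring A]
    (h : IsRightSerialRing (LaurentSeries A)) :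
    IsRightSerialRing A ∧ IsArtinian Aᵐᵒᵖ A := by
  have hnoeth : IsNoetherian Aᵐᵒᵖ A := isNoetherian_of_laurentSeries h
  have : IsNoetherianRing Aᵐᵒᵖ := isNoetherian_of_linearEquiv (MulOpposite.opLinearEquiv Aᵐᵒᵖ)
  have : IsSemiprimaryRing Aᵐᵒᵖ := isSemiprimaryRing_of_exists_pow_eq fun a => by
    obtain ⟨m, b, hb⟩ := exists_pow_eq_pow_succ_mul_of_laurentSeries h a.unop
    exact ⟨m, MulOpposite.op b, MulOpposite.unop_injective (by simpa using hb)⟩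
  have hart : IsArtinian Aᵐᵒᵖ A := IsSemiprimaryRing.isNoetherian_iff_isArtinian.1 hnoeth
  exact ⟨exists_iSupIndep_isUniserialModule (fun P hcompl hbot hP =>
    isUniserialModule_of_indecomposable h IsSemiprimaryRing.isNilpotent hcompl hbot hP) ⊤
      isComplemented_top, hart⟩
end

section
/- Let A be a (not necessarily commutative) ring. If A is a right serial right Artinian ring, then the Laurent series ring A((x)) is a right serial right Artinian ring. -/
section Uniserial

open Submodule

variable {R M : Type*} [Ring R] [AddCommGroup M] [Module R M]

theorem isUniserialModule_iff :
    IsUniserialModule R M ↔ ∀ x y : M, (∃ r : R, r • x = y) ∨ ∃ r : R, r • y = x := by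
  refine ⟨fun h x y ↦ ?_, fun h N₁ N₂ ↦ ?_⟩
  · simp only [← mem_span_singleton, ← span_singleton_le_iff_mem]
    exact h _ _
  · by_contra! hN
    obtain ⟨⟨x, hx₁, hx₂⟩, y, hy₂, hy₁⟩ := And.imp SetLike.not_le_iff_exists.mp
      SetLike.not_le_iff_exists.mp hN
    obtain ⟨r, rfl⟩ | ⟨r, rfl⟩ := h x y
    · exact hy₁ (N₁.smul_mem r hx₁)
    · exact hx₂ (N₂.smul_mem r hy₂)

theorem isUniserialModule_coe_iff {N : Submodule R M} :
    IsUniserialModule R N ↔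
      ∀ x ∈ N, ∀ y ∈ N, (∃ r : R, r • x = y) ∨ ∃ r : R, r • y = x := by
  simp [isUniserialModule_iff, Subtype.ext_iff]

/-- Over a ring which is semisimple modulo its Jacobson radical, if the elements of `R ∙ n` are
comparable with `m` and `m` does not generate `n`, then `m` lies in `J n`. -/
theorem exists_mem_jacobson_smul_eq [IsSemisimpleRing (R ⧸ Ring.jacobson R)] {n m : M}
    (h : ∀ s : R, (∃ r : R, r • s • n = m) ∨ ∃ r : R, r • m = s • n)
    (hn : ∀ r : R, r • m ≠ n) : ∃ j ∈ Ring.jacobson R, j • n = m := by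
  let π := Ideal.Quotient.mk (Ring.jacobson R)
  have hπ : Function.Surjective π := Ideal.Quotient.mk_surjective
  let L : Ideal R := (span R {m}).comap (LinearMap.toSpanSingleton R M n)
  have hL (b : R) : b ∈ L ↔ ∃ r : R, r • m = b • n := by simp [L, mem_span_singleton]
  obtain ⟨D, hD⟩ := exists_isCompl (L.map π)
  obtain ⟨l', hl', d, hd, hld⟩ := mem_sup.mp
    (hD.sup_eq_top ▸ mem_top (x := (1 : R ⧸ Ring.jacobson R)))
  obtain ⟨l, hl, rfl⟩ := (Ideal.mem_map_iff_of_surjective π hπ).mp hl'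
  have hd' : π (1 - l) ∈ D := by rwa [map_sub, map_one, ← hld, add_sub_cancel_left]
  obtain ⟨s, hs⟩ | ⟨s, hs⟩ := h (1 - l)
  · refine ⟨s * (1 - l), ?_, by rw [mul_smul, hs]⟩
    have h₁ : π (s * (1 - l)) ∈ D := by rw [map_mul]; exact D.mul_mem_left _ hd'
    have h₂ : π (s * (1 - l)) ∈ L.map π :=
      Ideal.mem_map_of_mem _ ((hL _).mpr ⟨1, by rw [mul_smul, hs, one_smul]⟩)
    exact Ideal.Quotient.eq_zero_iff_mem.mp
      ((Submodule.mem_bot _).mp (hD.inf_eq_bot ▸ mem_inf.mpr ⟨h₂, h₁⟩))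
  · obtain ⟨t, ht⟩ := (hL l).mp hl
    exact absurd (by rw [add_smul, hs, ht, sub_smul, one_smul, sub_add_cancel]) (hn (s + t))

end Uniserial

namespace LaurentSeries

open MulOpposite Submodule

variable {A : Type*} [Ring A]

theorem isNilpotent_of_coeff_mem {J : Ideal Aᵐᵒᵖ} (hJ : IsNilpotent J) {y : LaurentSeries A}
    (hy : ∀ i, op (y.coeff i) ∈ J) : IsNilpotent y := by
  have key (m : ℕ) : ∀ i, op ((y ^ m).coeff i) ∈ J ^ m := by
    induction m with
    | zero => simp [Submodule.pow_zero, Ideal.one_eq_top]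
    | succ m ih =>
      intro i
      rw [pow_succ' y, Submodule.pow_succ, HahnSeries.coeff_mul, Finset.op_sum]
      exact sum_mem fun p _ ↦ by rw [op_mul]; exact Ideal.mul_mem_mul (ih _) (hy _)
  obtain ⟨m, hm⟩ := hJ
  refine ⟨m, HahnSeries.ext (funext fun i ↦ ?_)⟩
  have := key m i
  rw [hm] at this
  simpa using this

theorem isUnit_of_coeff_eq_one {v : LaurentSeries A} {k : ℤ} (hk : v.coeff k = 1)
    (hlt : ∀ j < k, v.coeff j = 0) : IsUnit v := by
  let p : PowerSeries A := PowerSeries.mk fun i ↦ v.coeff (k + i)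
  have hp₀ : PowerSeries.constantCoeff p = ((1 : Aˣ) : A) := by simp [p, hk]
  have hp : IsUnit p := ⟨⟨p, p.invOfUnit 1, p.mul_invOfUnit 1 hp₀, p.invOfUnit_mul 1 hp₀⟩, rfl⟩
  have hs : IsUnit (HahnSeries.single k (1 : A)) :=
    ⟨⟨HahnSeries.single k 1, HahnSeries.single (-k) 1, by simp, by simp⟩, rfl⟩
  have hv : v = HahnSeries.single k 1 * HahnSeries.ofPowerSeries ℤ A p := by
    ext j
    rw [HahnSeries.coeff_single_mul, one_mul]
    obtain hj | hj := lt_or_ge j k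
    · rw [hlt j hj, HahnSeries.ofPowerSeries_apply, HahnSeries.embDomain_of_notMem_range]
      simp only [Set.mem_range, not_exists]
      intro i hi
      simp at hi
      omega
    · obtain ⟨i, rfl⟩ := Int.le.dest hj
      simp [p]
  rw [hv]
  exact hs.mul (hp.map _)

theorem isUnit_add_of_coeff_mem {J : Ideal Aᵐᵒᵖ} [J.IsTwoSided] (hJ : IsNilpotent J)
    {v w : LaurentSeries A} (hv : IsUnit v) (hw : ∀ i, op (w.coeff i) ∈ J) : IsUnit (v + w) := by
  obtain ⟨v, rfl⟩ := hv
  have : (v : LaurentSeries A) + w = v * (1 + ↑v⁻¹ * w) := by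
    rw [mul_add, mul_one, Units.mul_inv_cancel_left]
  rw [this]
  refine v.isUnit.mul (IsNilpotent.isUnit_one_add (isNilpotent_of_coeff_mem hJ fun i ↦ ?_))
  rw [HahnSeries.coeff_mul, Finset.op_sum]
  exact sum_mem fun p _ ↦ by rw [op_mul]; exact J.mul_mem_right _ (hw _)

/-- A Laurent series whose coefficients lie in a uniserial right ideal of a right Artinian ring is
a constant of that right ideal times a unit. -/
theorem exists_eq_C_mul_unit [IsArtinianRing Aᵐᵒᵖ] [IsNoetherian Aᵐᵒᵖ A] {N : Submodule Aᵐᵒᵖ A}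
    (hN : IsUniserialModule Aᵐᵒᵖ N) {f : LaurentSeries A} (hf : ∀ i, f.coeff i ∈ N) :
    ∃ n ∈ N, ∃ u : (LaurentSeries A)ˣ, f = HahnSeries.C n * (u : LaurentSeries A) := by
  rw [isUniserialModule_coe_iff] at hN
  obtain rfl | hf₀ := eq_or_ne f 0
  · exact ⟨0, N.zero_mem, 1, by simp⟩
  let P (k : ℤ) : Prop := ∀ j, f.coeff j ∈ span Aᵐᵒᵖ {f.coeff k}
  have hP : ∃ k, P k := by
    obtain ⟨_, ⟨k, rfl⟩, hk⟩ := WellFounded.has_min (wellFounded_gt (α := Submodule Aᵐᵒᵖ A))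
      (Set.range fun j ↦ span Aᵐᵒᵖ {f.coeff j}) (Set.range_nonempty _)
    refine ⟨k, fun j ↦ ?_⟩
    obtain h | h := hN _ (hf k) _ (hf j)
    · exact mem_span_singleton.mpr h
    · rw [← mem_span_singleton, ← span_singleton_le_iff_mem] at h
      exact (h.eq_of_not_lt (hk _ ⟨j, rfl⟩)) ▸ mem_span_singleton_self _
  have hP_ne {k : ℤ} (hk : P k) : f.coeff k ≠ 0 := fun h ↦
    hf₀ (HahnSeries.ext (funext fun j ↦ by simpa [h] using hk j))
  obtain ⟨k, hk, hmin⟩ := Int.exists_least_of_bdd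
    ⟨f.order, fun k hk ↦ HahnSeries.order_le_of_coeff_ne_zero (hP_ne hk)⟩ hP
  have hc (j : ℤ) : ∃ c : A, f.coeff k * c = f.coeff j ∧ (f.coeff j = 0 → c = 0) ∧
      (j < k → op c ∈ Ring.jacobson Aᵐᵒᵖ) ∧ (j = k → c = 1) := by
    obtain h₀ | h₀ := eq_or_ne (f.coeff j) 0
    · exact ⟨0, by simp [h₀], fun _ ↦ rfl, by simp, fun h ↦ absurd (h ▸ h₀) (hP_ne hk)⟩
    obtain hj | rfl | hj := lt_trichotomy j k
    · have hnot (r : Aᵐᵒᵖ) : r • f.coeff j ≠ f.coeff k := fun h ↦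
        hj.not_ge (hmin j fun i ↦ (span_singleton_le_iff_mem _ _).mpr
          (mem_span_singleton.mpr ⟨r, h⟩) (hk i))
      obtain ⟨c, hc, h⟩ := exists_mem_jacobson_smul_eq
        (fun s ↦ hN _ (N.smul_mem s (hf k)) _ (hf j)) hnot
      exact ⟨unop c, h, fun h ↦ absurd h h₀, fun _ ↦ hc, fun h ↦ absurd h hj.ne⟩
    · exact ⟨1, mul_one _, fun h ↦ absurd h h₀, fun h ↦ absurd h (lt_irrefl _), fun _ ↦ rfl⟩
    · obtain ⟨c, hc⟩ := mem_span_singleton.mp (hk j)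
      exact ⟨unop c, hc, fun h ↦ absurd h h₀, fun h ↦ absurd h hj.not_gt,
        fun h ↦ absurd h hj.ne'⟩
  choose c hfc hc₀ hcJ hc₁ using hc
  let v : LaurentSeries A := ⟨fun j ↦ if j < k then 0 else c j, f.isPWO_support.mono fun j hj h ↦
    hj (by simp [hc₀ j h])⟩
  let w : LaurentSeries A := ⟨fun j ↦ if j < k then c j else 0, f.isPWO_support.mono fun j hj h ↦
    hj (by simp [hc₀ j h])⟩
  have hu : IsUnit (v + w) := by
    refine isUnit_add_of_coeff_mem (J := Ring.jacobson Aᵐᵒᵖ) IsSemiprimaryRing.isNilpotent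
      (isUnit_of_coeff_eq_one (k := k) (by simp [v, hc₁]) fun j hj ↦ by simp [v, hj]) fun j ↦ ?_
    by_cases hj : j < k
    · simpa [w, hj] using hcJ j hj
    · simp [w, hj]
  refine ⟨f.coeff k, hf k, hu.unit, HahnSeries.ext (funext fun j ↦ ?_)⟩
  rw [IsUnit.unit_spec, HahnSeries.C_mul_eq_smul, HahnSeries.coeff_smul, smul_eq_mul, ← hfc j]
  congr 1
  by_cases hj : j < k <;> simp [v, w, hj]

/-- The right ideal of Laurent series with coefficients in a given right ideal. -/
def ofCoeffMem (N : Submodule Aᵐᵒᵖ A) : Submodule (LaurentSeries A)ᵐᵒᵖ (LaurentSeries A) where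
  carrier := {f | ∀ i, f.coeff i ∈ N}
  add_mem' hf hg i := N.add_mem (hf i) (hg i)
  zero_mem' _ := N.zero_mem
  smul_mem' g f hf i := by
    rw [smul_eq_mul_unop, HahnSeries.coeff_mul]
    exact sum_mem fun p _ ↦ N.smul_mem (op _) (hf _)

theorem mem_ofCoeffMem {N : Submodule Aᵐᵒᵖ A} {f : LaurentSeries A} :
    f ∈ ofCoeffMem N ↔ ∀ i, f.coeff i ∈ N := Iff.rfl

theorem isUniserialModule_ofCoeffMem [IsArtinianRing Aᵐᵒᵖ] [IsNoetherian Aᵐᵒᵖ A]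
    {N : Submodule Aᵐᵒᵖ A} (hN : IsUniserialModule Aᵐᵒᵖ N) :
    IsUniserialModule (LaurentSeries A)ᵐᵒᵖ (ofCoeffMem N) := by
  have key {n m : A} (u v : (LaurentSeries A)ˣ) (h : ∃ r : Aᵐᵒᵖ, r • n = m) :
      ∃ r : (LaurentSeries A)ᵐᵒᵖ, r • (HahnSeries.C n * (u : LaurentSeries A)) =
        HahnSeries.C m * (v : LaurentSeries A) := by
    obtain ⟨r, rfl⟩ := h
    refine ⟨op ((↑u⁻¹ : LaurentSeries A) *
      (HahnSeries.C (unop r) * (v : LaurentSeries A))), ?_⟩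
    rw [op_smul_eq_mul, mul_assoc, Units.mul_inv_cancel_left, ← mul_assoc, ← map_mul,
      smul_eq_mul_unop]
  refine isUniserialModule_coe_iff.mpr fun f hf g hg ↦ ?_
  obtain ⟨n, hn, u, rfl⟩ := exists_eq_C_mul_unit hN hf
  obtain ⟨m, hm, v, rfl⟩ := exists_eq_C_mul_unit hN hg
  exact (isUniserialModule_coe_iff.mp hN n hn m hm).imp (key u v) (key v u)

/-- The right ideal of constants of a right ideal of Laurent series. -/
def constants (Q : Submodule (LaurentSeries A)ᵐᵒᵖ (LaurentSeries A)) : Submodule Aᵐᵒᵖ A where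
  carrier := {a | HahnSeries.C a ∈ Q}
  add_mem' ha hb := by simpa using Q.add_mem ha hb
  zero_mem' := by simp
  smul_mem' r a ha := by
    simpa [smul_eq_mul_unop] using Q.smul_mem (op (HahnSeries.C (unop r))) ha

theorem le_of_constants_le [IsArtinianRing Aᵐᵒᵖ] [IsNoetherian Aᵐᵒᵖ A]
    {N : Submodule Aᵐᵒᵖ A} (hN : IsUniserialModule Aᵐᵒᵖ N)
    {Q Q' : Submodule (LaurentSeries A)ᵐᵒᵖ (LaurentSeries A)} (hQ : Q ≤ ofCoeffMem N)
    (h : constants Q ≤ constants Q') : Q ≤ Q' := by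
  intro f hf
  obtain ⟨n, -, u, rfl⟩ := exists_eq_C_mul_unit hN (hQ hf)
  refine Q'.smul_mem (op (u : LaurentSeries A)) (h (?_ : HahnSeries.C n ∈ Q))
  have hn := Q.smul_mem (op (↑u⁻¹ : LaurentSeries A)) hf
  rwa [op_smul_eq_mul, Units.mul_inv_cancel_right] at hn

theorem isArtinian_ofCoeffMem [IsArtinianRing Aᵐᵒᵖ] [IsNoetherian Aᵐᵒᵖ A] [IsArtinian Aᵐᵒᵖ A]
    {N : Submodule Aᵐᵒᵖ A} (hN : IsUniserialModule Aᵐᵒᵖ N) :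
    IsArtinian (LaurentSeries A)ᵐᵒᵖ (ofCoeffMem N) := by
  let F (Q : Submodule (LaurentSeries A)ᵐᵒᵖ (ofCoeffMem N)) : Submodule Aᵐᵒᵖ A :=
    constants (Q.map (ofCoeffMem N).subtype)
  have hF : StrictMono F := fun Q Q' h ↦ by
    refine lt_of_le_not_ge (fun a ha ↦ map_mono h.le ha) fun hle ↦ h.not_ge ?_
    exact (map_le_map_iff_of_injective (ofCoeffMem N).subtype_injective _ _).mp
      (le_of_constants_le hN (map_subtype_le _ _) hle)
  exact hF.wellFoundedLT

theorem iSupIndep_ofCoeffMem {ι : Type*} {N : ι → Submodule Aᵐᵒᵖ A} (hN : iSupIndep N) :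
    iSupIndep fun i ↦ ofCoeffMem (N i) := by
  classical
  rw [iSupIndep_iff_finsetSum_eq_zero_imp_eq_zero] at hN ⊢
  intro s f hf hsum i hi
  refine HahnSeries.ext (funext fun j ↦ ?_)
  exact hN s (fun i ↦ (f i).coeff j) (fun i hi ↦ hf i hi j)
    (by simpa using congrArg (HahnSeries.coeff · j) hsum) i hi

theorem iSup_ofCoeffMem_eq_top {ι : Type*} [Finite ι] {N : ι → Submodule Aᵐᵒᵖ A}
    (hN : ⨆ i, N i = ⊤) : ⨆ i, ofCoeffMem (N i) = ⊤ := by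
  cases nonempty_fintype ι
  obtain ⟨e, he, hsum⟩ := (mem_iSup_iff_exists_finsupp N 1).mp (hN ▸ mem_top)
  refine eq_top_iff.mpr fun f _ ↦ ?_
  have : f = ∑ i, HahnSeries.C (e i) * f := by
    rw [← Finset.sum_mul, ← map_sum, ← Finsupp.sum_fintype e (fun _ a ↦ a) (by simp), hsum]
    simp
  rw [this]
  refine sum_mem fun i _ ↦ mem_iSup_of_mem i fun j ↦ ?_
  rw [HahnSeries.C_mul_eq_smul, HahnSeries.coeff_smul]
  exact (N i).smul_mem (op _) (he i)

end LaurentSeries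

/-- If `A` is a right serial right Artinian ring, then the Laurent series ring
`A((x))` is a right serial right Artinian ring. -/
theorem laurentSeries_rightSerial_of_rightSerial (A : Type*) [Ring A]
    (h₁ : IsRightSerialRing A) (h₂ : IsArtinian Aᵐᵒᵖ A) :
    IsRightSerialRing (LaurentSeries A) ∧
      IsArtinian (LaurentSeries A)ᵐᵒᵖ (LaurentSeries A) := by
  let e : A ≃ₗ[Aᵐᵒᵖ] Aᵐᵒᵖ :=
    { MulOpposite.opAddEquiv with map_smul' := fun _ _ ↦ rfl }
  have : IsArtinianRing Aᵐᵒᵖ := e.isArtinian_iff.mp h₂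
  have : IsNoetherian Aᵐᵒᵖ A := isNoetherian_of_linearEquiv e.symm
  obtain ⟨ι, _, N, hind, hsup, huni⟩ := h₁
  have htop := LaurentSeries.iSup_ofCoeffMem_eq_top hsup
  refine ⟨⟨ι, ‹_›, fun i ↦ LaurentSeries.ofCoeffMem (N i),
    LaurentSeries.iSupIndep_ofCoeffMem hind, htop,
    fun i ↦ LaurentSeries.isUniserialModule_ofCoeffMem (huni i)⟩, ?_⟩
  have (i : ι) := LaurentSeries.isArtinian_ofCoeffMem (huni i)
  exact Submodule.topEquiv.isArtinian_iff.mp (htop ▸ isArtinian_iSup)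
end

section
/- Let A be a (not necessarily commutative) ring. The Laurent series ring A((x)) is a serial ring (i.e. both the right module A((x)) over itself and the left module A((x)) over itself are serial modules) if and only if A is a serial ring that is Artinian (both right and left Artinian). -/
namespace LaurentSeries

variable {A : Type*} [Ring A]

theorem coeff_mul_mem_s3 {f g : LaurentSeries A} {n : ℤ} (N : AddSubgroup A)
    (h : ∀ i j, i + j = n → f.coeff i * g.coeff j ∈ N) : (f * g).coeff n ∈ N := by
  rw [HahnSeries.coeff_mul]
  exact sum_mem fun ij hij => h _ _ (Finset.mem_antidiagonal.mp hij).2.2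

theorem coeff_mul_sub_mem {f g : LaurentSeries A} (m n : ℤ) (N : AddSubgroup A)
    (h : ∀ i j, i + j = m + n → i ≠ m → f.coeff i * g.coeff j ∈ N) :
    (f * g).coeff (m + n) - f.coeff m * g.coeff n ∈ N := by
  classical
  have key : (f * g).coeff (m + n) - f.coeff m * g.coeff n =
      ((f - HahnSeries.single m (f.coeff m)) * g).coeff (m + n) := by
    rw [sub_mul, HahnSeries.coeff_sub, HahnSeries.coeff_single_mul, add_sub_cancel_left]
  rw [key]
  refine coeff_mul_mem_s3 N fun i j hij => ?_
  by_cases hi : i = m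
  · subst hi
    simp
  · rw [HahnSeries.coeff_sub, HahnSeries.coeff_single_of_ne hi, sub_zero]
    exact h i j hij hi

theorem exists_forall_lt_coeff_eq_zero (f : LaurentSeries A) :
    ∃ p : ℤ, ∀ i < p, f.coeff i = 0 :=
  ⟨f.order, fun _ hi => HahnSeries.coeff_eq_zero_of_lt_order hi⟩

/-- A predicate on coefficients that holds somewhere, but not at zero, holds at a smallest
exponent. -/
theorem exists_min_coeff (f : LaurentSeries A) (P : A → Prop) (h0 : ¬ P 0)
    (h : ∃ n, P (f.coeff n)) : ∃ m, P (f.coeff m) ∧ ∀ i < m, ¬ P (f.coeff i) := by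
  obtain ⟨p, hp⟩ := exists_forall_lt_coeff_eq_zero f
  obtain ⟨m, hm, hmin⟩ := Int.exists_least_of_bdd (P := fun n => P (f.coeff n))
    ⟨p, fun z hz => by
      by_contra! hlt
      exact h0 (hp z hlt ▸ hz)⟩ h
  exact ⟨m, hm, fun i hi hPi => absurd (hmin i hPi) (not_le.mpr hi)⟩

theorem single_one_commute (m : ℤ) (f : LaurentSeries A) :
    Commute (HahnSeries.single m (1 : A)) f := by
  ext n
  rw [HahnSeries.coeff_single_mul, HahnSeries.coeff_mul_single, one_mul, mul_one]

/-- The left ideal of Laurent series all of whose coefficients lie in a left ideal. -/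
def extend (N : Submodule A A) : Submodule (LaurentSeries A) (LaurentSeries A) where
  carrier := {f | ∀ n, f.coeff n ∈ N}
  add_mem' hf hg n := N.add_mem (hf n) (hg n)
  zero_mem' _ := N.zero_mem
  smul_mem' _ _ hf _ := coeff_mul_mem_s3 N.toAddSubgroup fun _ j _ => N.smul_mem _ (hf j)

theorem mem_extend {N : Submodule A A} {f : LaurentSeries A} :
    f ∈ extend N ↔ ∀ n, f.coeff n ∈ N := Iff.rfl

theorem C_mem_extend {N : Submodule A A} {a : A} : HahnSeries.C a ∈ extend N ↔ a ∈ N := by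
  refine ⟨fun h => by simpa using h 0, fun h n => ?_⟩
  rw [HahnSeries.C_apply, HahnSeries.coeff_single]
  split_ifs
  exacts [h, N.zero_mem]

/-- The coefficients of the solution `b` of `b * F = H`, computed recursively, where `s` solves
equations in the lowest coefficient of `F`. -/
noncomputable def divCoeff (s : A → A) (F H : ℕ → A) : ℕ → A
  | n => s (H n - ∑ i : Fin n, divCoeff s F H i * F (n - i))
decreasing_by exact i.2

theorem eq_single_mul_ofPowerSeries {f : LaurentSeries A} {m : ℤ}
    (hm : ∀ n < m, f.coeff n = 0) :
    f = HahnSeries.single m 1 *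
      HahnSeries.ofPowerSeries ℤ A (PowerSeries.mk fun n : ℕ => f.coeff (m + n)) := by
  ext n
  rw [HahnSeries.coeff_single_mul, one_mul]
  rcases lt_or_ge n m with h | h
  · rw [hm n h, PowerSeries.coeff_coe, if_pos (sub_neg.mpr h)]
  · obtain ⟨k, rfl⟩ := Int.le.dest h
    rw [add_sub_cancel_left, HahnSeries.ofPowerSeries_apply_coeff, PowerSeries.coeff_mk]

theorem exists_mul_eq {f h : LaurentSeries A} {N : Submodule A A} {m : ℤ}
    (hm : ∀ n < m, f.coeff n = 0) (hf : f ∈ extend N)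
    (hN : ∀ z ∈ N, ∃ a, a * f.coeff m = z) (hh : h ∈ extend N) : ∃ b, b * f = h := by
  choose! s hs using hN
  obtain ⟨p, hp⟩ := exists_forall_lt_coeff_eq_zero h
  set F : ℕ → A := fun n => f.coeff (m + n)
  set H : ℕ → A := fun n => h.coeff (p + n)
  have key : PowerSeries.mk (divCoeff s F H) * PowerSeries.mk F = PowerSeries.mk H := by
    ext n
    rw [PowerSeries.coeff_mul, Finset.Nat.sum_antidiagonal_eq_sum_range_succ_mk,
      Finset.sum_range_succ]
    simp only [PowerSeries.coeff_mk, Nat.sub_self]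
    rw [divCoeff, Finset.sum_range (fun i => divCoeff s F H i * F (n - i))]
    have : F 0 = f.coeff m := by simp [F]
    rw [this, hs, add_sub_cancel]
    exact N.sub_mem (hh _) (sum_mem fun i _ => N.smul_mem _ (hf _))
  refine ⟨HahnSeries.single (p - m) 1 *
    HahnSeries.ofPowerSeries ℤ A (PowerSeries.mk (divCoeff s F H)), ?_⟩
  rw [eq_single_mul_ofPowerSeries hm, eq_single_mul_ofPowerSeries hp, ← key, map_mul,
    mul_assoc, ← mul_assoc (HahnSeries.ofPowerSeries ℤ A _), ← (single_one_commute m _).eq,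
    mul_assoc, ← mul_assoc, HahnSeries.single_mul_single, sub_add_cancel, one_mul]

end LaurentSeries

section Serial

theorem isUniserialModule_submodule_iff {R M : Type*} [Ring R] [AddCommGroup M] [Module R M]
    (N : Submodule R M) :
    IsUniserialModule R N ↔ ∀ X ≤ N, ∀ Y ≤ N, X ≤ Y ∨ Y ≤ X := by
  refine ⟨fun h X hX Y hY => ?_, fun h X Y => ?_⟩
  · have := h (N.mapIic.symm ⟨X, hX⟩) (N.mapIic.symm ⟨Y, hY⟩)
    rwa [OrderIso.le_iff_le, OrderIso.le_iff_le] at this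
  · have := h _ (N.mapIic X).2 _ (N.mapIic Y).2
    rw [← N.mapIic.le_iff_le, ← N.mapIic.le_iff_le (x := Y)]
    exact this

theorem isUniserialModule_submodule_iff_mem {R M : Type*} [Ring R] [AddCommGroup M] [Module R M]
    (N : Submodule R M) :
    IsUniserialModule R N ↔
      ∀ x ∈ N, ∀ y ∈ N, x ∈ Submodule.span R {y} ∨ y ∈ Submodule.span R {x} := by
  rw [isUniserialModule_submodule_iff]
  refine ⟨fun h x hx y hy => ?_, fun h X hX Y hY => ?_⟩
  · simpa only [Submodule.span_singleton_le_iff_mem] using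
      h (.span R {x}) (by simpa using hx) (.span R {y}) (by simpa using hy)
  · by_contra! hXY
    obtain ⟨x, hx, hxY⟩ := SetLike.not_le_iff_exists.mp hXY.1
    obtain ⟨y, hy, hyX⟩ := SetLike.not_le_iff_exists.mp hXY.2
    rcases h x (hX hx) y (hY hy) with h | h
    · exact hxY ((Submodule.span_singleton_le_iff_mem y Y).mpr hy h)
    · exact hyX ((Submodule.span_singleton_le_iff_mem x X).mpr hx h)

/-- A complete lattice is serial if its top element is a finite independent supremum of elements
below which the order is total. A module is serial if and only if its submodule lattice is. -/
def IsSerialLattice (L : Type*) [CompleteLattice L] : Prop :=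
  ∃ (ι : Type) (_ : Fintype ι) (N : ι → L),
    iSupIndep N ∧ (⨆ i, N i) = ⊤ ∧ ∀ i, ∀ X ≤ N i, ∀ Y ≤ N i, X ≤ Y ∨ Y ≤ X

theorem IsSerialLattice.of_orderIso {L L' : Type*} [CompleteLattice L] [CompleteLattice L']
    (e : L ≃o L') (h : IsSerialLattice L) : IsSerialLattice L' := by
  obtain ⟨ι, hι, N, ind, sup, uni⟩ := h
  refine ⟨ι, hι, e ∘ N, (iSupIndep_map_orderIso_iff e).mpr ind, ?_, fun i X hX Y hY => ?_⟩
  · simp only [Function.comp_apply, ← e.map_iSup, sup, e.map_top]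
  · rw [← e.symm.le_iff_le, ← e.symm.le_iff_le (x := Y)]
    exact uni i _ (e.symm_apply_le.mpr hX) _ (e.symm_apply_le.mpr hY)

theorem OrderIso.isSerialLattice_congr {L L' : Type*} [CompleteLattice L] [CompleteLattice L']
    (e : L ≃o L') : IsSerialLattice L ↔ IsSerialLattice L' :=
  ⟨.of_orderIso e, .of_orderIso e.symm⟩

variable (R : Type*) [Ring R]

theorem isLeftSerialRing_iff_isSerialLattice :
    IsLeftSerialRing R ↔ IsSerialLattice (Submodule R R) := by
  simp only [IsLeftSerialRing, IsSerialLattice, isUniserialModule_submodule_iff]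

theorem isRightSerialRing_iff_isSerialLattice :
    IsRightSerialRing R ↔ IsSerialLattice (Submodule Rᵐᵒᵖ R) := by
  simp only [IsRightSerialRing, IsSerialLattice, isUniserialModule_submodule_iff]

/-- A ring acting on itself from the right, viewed as the opposite ring acting on itself from the
left. -/
def opSelfLinearEquiv : R ≃ₗ[Rᵐᵒᵖ] Rᵐᵒᵖ where
  __ := MulOpposite.opAddEquiv
  map_smul' _ _ := rfl

theorem isRightSerialRing_iff_op : IsRightSerialRing R ↔ IsLeftSerialRing Rᵐᵒᵖ := by
  rw [isRightSerialRing_iff_isSerialLattice, isLeftSerialRing_iff_isSerialLattice]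
  exact (Submodule.orderIsoMapComap (opSelfLinearEquiv R)).isSerialLattice_congr

variable {R}

theorem RingEquiv.isLeftSerialRing_iff {S : Type*} [Ring S] (e : R ≃+* S) :
    IsLeftSerialRing R ↔ IsLeftSerialRing S := by
  rw [isLeftSerialRing_iff_isSerialLattice, isLeftSerialRing_iff_isSerialLattice]
  have := RingHomInvPair.of_ringEquiv e
  have := this.symm
  exact (Submodule.orderIsoMapComap e.toSemilinearEquiv).isSerialLattice_congr

theorem CompleteOrthogonalIdempotents.iSupIndep_span {ι : Type*} [Fintype ι] {e : ι → R}
    (he : CompleteOrthogonalIdempotents e) : iSupIndep fun i => Submodule.span R {e i} := by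
  intro i
  rw [Submodule.disjoint_def]
  intro x hx hx'
  obtain ⟨a, rfl⟩ := Submodule.mem_span_singleton.mp hx
  have hle : ⨆ j, ⨆ (_ : j ≠ i), Submodule.span R {e j} ≤
      LinearMap.ker (LinearMap.toSpanSingleton R R (e i)) := by
    refine iSup₂_le fun j hj => ?_
    rw [Submodule.span_singleton_le_iff_mem, LinearMap.mem_ker, LinearMap.toSpanSingleton_apply,
      smul_eq_mul, he.ortho hj]
  have := hle hx'
  rwa [LinearMap.mem_ker, LinearMap.toSpanSingleton_apply, smul_eq_mul, smul_eq_mul, mul_assoc,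
    (he.idem i).eq] at this

theorem CompleteOrthogonalIdempotents.iSup_span_eq_top {ι : Type*} [Fintype ι] {e : ι → R}
    (he : CompleteOrthogonalIdempotents e) : ⨆ i, Submodule.span R {e i} = ⊤ := by
  rw [Ideal.eq_top_iff_one, ← he.complete]
  exact sum_mem fun i _ => Submodule.mem_iSup_of_mem i (Submodule.mem_span_singleton_self _)

theorem exists_completeOrthogonalIdempotents_of_iSupIndep {ι : Type*} [Fintype ι]
    {N : ι → Submodule R R} (ind : iSupIndep N) (sup : ⨆ i, N i = ⊤) :
    ∃ e : ι → R, CompleteOrthogonalIdempotents e ∧ ∀ i, N i = Submodule.span R {e i} := by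
  classical
  let := (DirectSum.isInternal_submodule_of_iSupIndep_of_iSup_eq_top ind sup).chooseDecomposition
  refine ⟨DirectSum.idempotent N, DirectSum.completeOrthogonalIdempotents_idempotent N,
    fun i => le_antisymm (fun x hx => ?_) ?_⟩
  · rw [← DirectSum.decompose_of_mem_same N hx, DirectSum.decompose_eq_mul_idempotent]
    exact Submodule.smul_mem _ _ (Submodule.mem_span_singleton_self _)
  · rw [Submodule.span_singleton_le_iff_mem]
    exact (DirectSum.decompose N 1 i).2

theorem isLeftSerialRing_iff_exists_idempotents :
    IsLeftSerialRing R ↔ ∃ (ι : Type) (_ : Fintype ι) (e : ι → R),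
      CompleteOrthogonalIdempotents e ∧ ∀ i, IsUniserialModule R (Submodule.span R {e i}) := by
  refine ⟨fun ⟨ι, hι, N, ind, sup, uni⟩ => ?_, fun ⟨ι, hι, e, he, uni⟩ =>
    ⟨ι, hι, _, he.iSupIndep_span, he.iSup_span_eq_top, uni⟩⟩
  obtain ⟨e, he, hN⟩ := exists_completeOrthogonalIdempotents_of_iSupIndep ind sup
  exact ⟨ι, hι, e, he, fun i => hN i ▸ uni i⟩

end Serial

section Op

variable (A : Type*) [Ring A]

/-- The opposite of a Laurent series ring is the Laurent series ring over the opposite ring. -/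
def LaurentSeries.opRingEquiv : (LaurentSeries A)ᵐᵒᵖ ≃+* LaurentSeries Aᵐᵒᵖ where
  toFun f := f.unop.map (MulOpposite.opAddEquiv : A ≃+ Aᵐᵒᵖ)
  invFun f := .op (f.map (MulOpposite.opAddEquiv : A ≃+ Aᵐᵒᵖ).symm)
  left_inv f := by
    apply MulOpposite.unop_injective
    ext n
    simp
  right_inv f := by
    ext n
    simp
  map_add' f g := by
    ext n
    simp
  map_mul' f g := by
    ext n
    simp only [HahnSeries.map_coeff, HahnSeries.coeff_mul, MulOpposite.unop_mul, map_sum]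
    refine Finset.sum_nbij' Prod.swap Prod.swap ?_ ?_ ?_ ?_ ?_ <;>
      simp +contextual [Finset.mem_antidiagonal, add_comm]

end Op

section Nakayama

variable {R : Type*} [Ring R] {M : Type*} [AddCommGroup M] [Module R M]

theorem Submodule.le_of_le_sup_smul_of_isNilpotent {I : Ideal R} [I.IsTwoSided]
    (hI : IsNilpotent I) {N X : Submodule R M} (h : N ≤ X ⊔ I • N) : N ≤ X := by
  obtain ⟨n, hn⟩ := hI
  have key : ∀ k, N ≤ X ⊔ (I ^ k) • N := by
    intro k
    induction k with
    | zero =>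
      rw [Submodule.pow_zero, Ideal.one_eq_top, Submodule.top_smul]
      exact le_sup_right
    | succ k ih =>
      refine ih.trans (sup_le le_sup_left ?_)
      calc (I ^ k) • N ≤ (I ^ k) • (X ⊔ I • N) := smul_mono_right _ h
        _ = (I ^ k) • X ⊔ (I ^ k) • I • N := Submodule.smul_sup _ _ _
        _ ≤ X ⊔ (I ^ (k + 1)) • N := by
          rw [Submodule.pow_succ, Submodule.mul_smul]
          exact sup_le_sup_right Submodule.smul_le_right _
  refine (key n).trans (sup_le le_rfl ?_)
  rw [hn, Ideal.zero_eq_bot, Submodule.bot_smul]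
  exact bot_le

theorem span_singleton_eq_top_of_isUniserialModule {I : Ideal R} [I.IsTwoSided]
    [IsSemisimpleRing (R ⧸ I)] (hI : IsNilpotent I) (hM : IsUniserialModule R M) {z : M}
    (hz : z ∉ I • (⊤ : Submodule R M)) : Submodule.span R {z} = ⊤ := by
  set K := I • (⊤ : Submodule R M)
  have tors := Module.isTorsionBySet_quotient_ideal_smul M I
  let _ := tors.module
  have : IsSemisimpleModule R (M ⧸ K) := tors.isSemisimpleModule_iff.mp inferInstance
  obtain ⟨Q, hQ⟩ := exists_isCompl ((Submodule.span R {z}).map K.mkQ)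
  have hne : (Submodule.span R {z}).map K.mkQ ≠ ⊥ := by
    rw [Submodule.map_span, Set.image_singleton, Ne, Submodule.span_singleton_eq_bot,
      Submodule.mkQ_apply, Submodule.Quotient.mk_eq_zero]
    exact hz
  have hle : Q ≤ (Submodule.span R {z}).map K.mkQ := by
    by_contra hcon
    have := (hM (((Submodule.span R {z}).map K.mkQ).comap K.mkQ) (Q.comap K.mkQ)).resolve_right
      fun h => hcon ?_
    · have h2 := Submodule.map_mono (f := K.mkQ) this
      rw [Submodule.map_comap_eq_of_surjective K.mkQ_surjective,
        Submodule.map_comap_eq_of_surjective K.mkQ_surjective] at h2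
      exact hne (le_bot_iff.mp (hQ.disjoint le_rfl h2))
    · have h2 := Submodule.map_mono (f := K.mkQ) h
      rwa [Submodule.map_comap_eq_of_surjective K.mkQ_surjective,
        Submodule.map_comap_eq_of_surjective K.mkQ_surjective] at h2
  have htop : (Submodule.span R {z}).map K.mkQ = ⊤ := by
    rw [← hQ.sup_eq_top, sup_eq_left.mpr hle]
  have h3 := congrArg (Submodule.comap K.mkQ) htop
  rw [Submodule.comap_map_eq, Submodule.ker_mkQ, Submodule.comap_top] at h3
  exact top_le_iff.mp (Submodule.le_of_le_sup_smul_of_isNilpotent hI h3.ge)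

theorem span_singleton_eq_of_isUniserialModule {I : Ideal R} [I.IsTwoSided]
    [IsSemisimpleRing (R ⧸ I)] (hI : IsNilpotent I) {N : Submodule R M}
    (hN : IsUniserialModule R N) {z : M} (hzN : z ∈ N) (hz : z ∉ I • N) :
    Submodule.span R {z} = N := by
  have := span_singleton_eq_top_of_isUniserialModule hI hN (z := ⟨z, hzN⟩) fun h => hz <| by
    have h2 := Submodule.mem_map_of_mem (f := N.subtype) h
    rwa [Submodule.map_smul'', Submodule.map_subtype_top] at h2
  have h2 := congrArg (Submodule.map N.subtype) this
  rwa [Submodule.map_span, Set.image_singleton, Submodule.map_subtype_top] at h2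

theorem IsUniserialModule.mono {N X : Submodule R M} (hN : IsUniserialModule R N) (h : X ≤ N) :
    IsUniserialModule R X := by
  rw [isUniserialModule_submodule_iff] at *
  exact fun Y hY Z hZ => hN Y (hY.trans h) Z (hZ.trans h)

end Nakayama

namespace LaurentSeries

variable {A : Type*} [Ring A]

theorem extend_mono {N N' : Submodule A A} (h : N ≤ N') : extend N ≤ extend N' :=
  fun _ hf n => h (hf n)

theorem extend_bot : extend (⊥ : Submodule A A) = ⊥ := by
  ext f
  simp only [mem_extend, Submodule.mem_bot, HahnSeries.ext_iff, funext_iff, HahnSeries.coeff_zero]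

theorem extend_span_of_isIdempotentElem {e : A} (he : IsIdempotentElem e) :
    extend (Submodule.span A {e}) =
      Submodule.span (LaurentSeries A) {(HahnSeries.C e : LaurentSeries A)} := by
  apply le_antisymm
  · intro f hf
    refine Submodule.mem_span_singleton.mpr ⟨f, ?_⟩
    ext n
    rw [smul_eq_mul, HahnSeries.C_apply, HahnSeries.coeff_mul_single_zero]
    obtain ⟨a, ha⟩ := Submodule.mem_span_singleton.mp (hf n)
    rw [← ha, smul_eq_mul, mul_assoc, he.eq]
  · rw [Submodule.span_singleton_le_iff_mem, C_mem_extend]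
    exact Submodule.mem_span_singleton_self e

theorem exists_generator_pow {I : Ideal A} [I.IsTwoSided] {N : Submodule A A} {c : A}
    (hc : Submodule.span A {c} = N) {k : ℕ} (hk : ¬ (I ^ k) • N ≤ (I ^ (k + 1)) • N) :
    ∃ a ∈ I ^ k, a * c ∈ (I ^ k) • N ∧ a * c ∉ (I ^ (k + 1)) • N := by
  by_contra! hcon
  refine hk (Submodule.smul_le.mpr fun a ha z hz => ?_)
  rw [← hc] at hz
  obtain ⟨b, rfl⟩ := Submodule.mem_span_singleton.mp hz
  rw [smul_smul]
  have hab : a * b ∈ I ^ k := Ideal.mul_mem_right _ _ ha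
  refine hcon _ hab (Submodule.smul_mem_smul hab ?_)
  rw [← hc]
  exact Submodule.mem_span_singleton_self c

/-- The part of a Laurent series with exponents at least `m`. -/
def trunc (m : ℤ) (f : LaurentSeries A) : LaurentSeries A where
  coeff n := if m ≤ n then f.coeff n else 0
  isPWO_support' := f.isPWO_support.mono fun n hn => by
    simp only [Function.mem_support, ne_eq, ite_eq_right_iff, Classical.not_imp] at hn
    exact hn.2

theorem coeff_trunc (m : ℤ) (f : LaurentSeries A) (n : ℤ) :
    (trunc m f).coeff n = if m ≤ n then f.coeff n else 0 := rfl

theorem exists_sub_mem_extend_pow_succ {I : Ideal A} [I.IsTwoSided] [IsSemisimpleRing (A ⧸ I)]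
    (hI : IsNilpotent I) {N : Submodule A A} (hN : IsUniserialModule A N) {f : LaurentSeries A}
    (hf : f ∈ extend N) (hf' : f ∉ extend (I • N)) (k : ℕ) {h : LaurentSeries A}
    (hh : h ∈ extend ((I ^ k) • N)) : ∃ b, h - b * f ∈ extend ((I ^ (k + 1)) • N) := by
  by_cases hk : (I ^ k) • N ≤ (I ^ (k + 1)) • N
  · exact ⟨0, by simpa using extend_mono hk hh⟩
  obtain ⟨m, hm, hlt⟩ := exists_min_coeff f (· ∉ I • N) (by simp)
    (by simpa only [mem_extend, not_forall] using hf')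
  simp only [not_not] at hlt
  obtain ⟨a, ha, hak, hak'⟩ := exists_generator_pow
    (span_singleton_eq_of_isUniserialModule hI hN (hf m) hm) hk
  have hgen := span_singleton_eq_of_isUniserialModule hI (hN.mono Submodule.smul_le_right) hak
    (by rwa [← Submodule.mul_smul, ← Ideal.IsTwoSided.pow_succ])
  set g := HahnSeries.C a * f with hg
  have gcoeff : ∀ n, g.coeff n = a * f.coeff n := fun n => by
    rw [hg, HahnSeries.C_apply, HahnSeries.coeff_single_zero_mul]
  obtain ⟨b, hb⟩ := exists_mul_eq (f := trunc m g) (h := h) (N := (I ^ k) • N) (m := m)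
    (fun n hn => by rw [coeff_trunc, if_neg (not_le.mpr hn)])
    (fun n => by
      rw [coeff_trunc]
      split_ifs
      · rw [gcoeff]
        exact Submodule.smul_mem_smul ha (hf n)
      · exact zero_mem _)
    (fun z hz => by
      rw [← hgen] at hz
      rw [coeff_trunc, if_pos le_rfl, gcoeff]
      exact Submodule.mem_span_singleton.mp hz) hh
  refine ⟨b * HahnSeries.C a, ?_⟩
  rw [mul_assoc, ← hg, ← hb, ← mul_sub, ← smul_eq_mul]
  refine Submodule.smul_mem _ _ fun n => ?_
  rw [HahnSeries.coeff_sub, coeff_trunc]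
  split_ifs with hmn
  · simp
  · rw [zero_sub, gcoeff, Submodule.pow_succ, Submodule.mul_smul]
    exact neg_mem (Submodule.smul_mem_smul ha (hlt n (not_le.mp hmn)))

theorem span_singleton_eq_extend {I : Ideal A} [I.IsTwoSided] [IsSemisimpleRing (A ⧸ I)]
    (hI : IsNilpotent I) {N : Submodule A A} (hN : IsUniserialModule A N) {f : LaurentSeries A}
    (hf : f ∈ extend N) (hf' : f ∉ extend (I • N)) :
    Submodule.span (LaurentSeries A) {f} = extend N := by
  refine le_antisymm ((Submodule.span_singleton_le_iff_mem _ _).mpr hf) fun h hh => ?_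
  have key : ∀ k, ∃ b, h - b * f ∈ extend ((I ^ k) • N) := by
    intro k
    induction k with
    | zero => exact ⟨0, by simpa [Submodule.pow_zero, Ideal.one_eq_top] using hh⟩
    | succ k ih =>
      obtain ⟨b, hb⟩ := ih
      obtain ⟨c, hc⟩ := exists_sub_mem_extend_pow_succ hI hN hf hf' k hb
      exact ⟨b + c, by rwa [add_mul, ← sub_sub]⟩
  obtain ⟨n, hn⟩ := hI
  obtain ⟨b, hb⟩ := key n
  rw [hn, Ideal.zero_eq_bot, Submodule.bot_smul, extend_bot, Submodule.mem_bot, sub_eq_zero] at hb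
  exact Submodule.mem_span_singleton.mpr ⟨b, hb.symm⟩

theorem isUniserialModule_extend [IsArtinian A A] {N : Submodule A A}
    (hN : IsUniserialModule A N) : IsUniserialModule (LaurentSeries A) (extend N) := by
  have hA : IsArtinianRing A := ‹_›
  have key : ∀ f ∈ extend N, ∃ X ≤ N, Submodule.span (LaurentSeries A) {f} = extend X := by
    intro f hf
    obtain ⟨X, ⟨hXN, hfX⟩, hmin⟩ := WellFounded.has_min (wellFounded_lt (α := Submodule A A))
      {X | X ≤ N ∧ f ∈ extend X} ⟨N, le_rfl, hf⟩
    refine ⟨X, hXN, ?_⟩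
    by_cases hfX' : f ∈ extend (Ring.jacobson A • X)
    · have hle : Ring.jacobson A • X ≤ X := Submodule.smul_le_right
      have heq : Ring.jacobson A • X = X := by
        by_contra hne
        exact hmin _ ⟨hle.trans hXN, hfX'⟩ (lt_of_le_of_ne hle hne)
      have hX : X = ⊥ := le_bot_iff.mp (Submodule.le_of_le_sup_smul_of_isNilpotent
        (IsSemiprimaryRing.isNilpotent (R := A)) (heq.ge.trans le_sup_right))
      rw [hX, extend_bot, Submodule.span_singleton_eq_bot]
      rwa [hX, extend_bot, Submodule.mem_bot] at hfX
    · exact span_singleton_eq_extend IsSemiprimaryRing.isNilpotent (hN.mono hXN) hfX hfX'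
  rw [isUniserialModule_submodule_iff_mem]
  intro f hf g hg
  obtain ⟨X, hX, hfX⟩ := key f hf
  obtain ⟨Y, hY, hgY⟩ := key g hg
  rw [← Submodule.span_singleton_le_iff_mem, ← Submodule.span_singleton_le_iff_mem, hfX, hgY]
  exact ((isUniserialModule_submodule_iff N).mp hN X hX Y hY).imp extend_mono extend_mono

theorem isLeftSerialRing_of_isArtinian [IsArtinian A A] (hA : IsLeftSerialRing A) :
    IsLeftSerialRing (LaurentSeries A) := by
  rw [isLeftSerialRing_iff_exists_idempotents] at *
  obtain ⟨ι, hι, e, he, huni⟩ := hA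
  refine ⟨ι, hι, _, he.map HahnSeries.C, fun i => ?_⟩
  rw [Function.comp_apply, ← extend_span_of_isIdempotentElem (he.idem i)]
  exact isUniserialModule_extend (huni i)

end LaurentSeries

section Elimination

variable {R : Type*} [Ring R] {M : Type*} [AddCommGroup M] [Module R M]

theorem exists_forall_mem_span_of_isUniserialModule {ι : Type*} {U : Submodule R M}
    (hU : IsUniserialModule R U) {s : Finset ι} (hs : s.Nonempty) {u : ι → M}
    (hu : ∀ i ∈ s, u i ∈ U) : ∃ i ∈ s, ∀ j ∈ s, u j ∈ Submodule.span R {u i} := by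
  rw [isUniserialModule_submodule_iff_mem] at hU
  induction hs using Finset.Nonempty.cons_induction with
  | singleton a => exact ⟨a, by simp, by simp⟩
  | cons a s ha hs ih =>
    simp only [Finset.mem_cons, forall_eq_or_imp] at hu
    obtain ⟨i, hi, hmax⟩ := ih hu.2
    rcases hU (u a) hu.1 (u i) (hu.2 i hi) with h | h
    · refine ⟨i, Finset.mem_cons_of_mem hi, fun j hj => ?_⟩
      rcases Finset.mem_cons.mp hj with rfl | hj
      exacts [h, hmax j hj]
    · refine ⟨a, Finset.mem_cons_self _ _, fun j hj => ?_⟩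
      rcases Finset.mem_cons.mp hj with rfl | hj
      · exact Submodule.mem_span_singleton_self _
      · exact (Submodule.span_singleton_le_iff_mem _ _).mpr h (hmax j hj)

/-- In a sum of `n` uniserial submodules, more than `n` submodules cannot be separated by elements
each lying in all but one of them. -/
theorem exists_mem_of_forall_mem_of_ne {ι κ : Type*} {U : κ → Submodule R M}
    (hU : ∀ k, IsUniserialModule R (U k)) (L : ι → Submodule R M) (t : Finset κ) :
    ∀ (s : Finset ι) (y : ι → M), t.card < s.card → (∀ i ∈ s, y i ∈ ⨆ k ∈ t, U k) →
      (∀ i ∈ s, ∀ j ∈ s, i ≠ j → y i ∈ L j) → ∃ i ∈ s, y i ∈ L i := by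
  classical
  induction t using Finset.induction_on with
  | empty =>
    intro s y hcard hy _
    obtain ⟨i, hi⟩ := Finset.card_pos.mp hcard
    have : y i = 0 := by simpa using hy i hi
    exact ⟨i, hi, this ▸ zero_mem _⟩
  | insert k t hk ih =>
    intro s y hcard hy hL
    rw [Finset.card_insert_of_notMem hk] at hcard
    simp only [Finset.iSup_insert, Submodule.mem_sup] at hy
    choose! u hu v hv huv using hy
    obtain ⟨i₀, hi₀, hmax⟩ := exists_forall_mem_span_of_isUniserialModule (hU k)
      (Finset.card_pos.mp (by omega)) hu
    simp only [Submodule.mem_span_singleton] at hmax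
    choose! a ha using hmax
    have hsub : ∀ i ∈ s.erase i₀, i ∈ s := fun i hi => Finset.mem_of_mem_erase hi
    obtain ⟨i, hi, hmem⟩ := ih (s.erase i₀) (fun i => y i - a i • y i₀)
      (by rw [Finset.card_erase_of_mem hi₀]; omega)
      (fun i hi => by
        have : y i - a i • y i₀ = v i - a i • v i₀ := by
          rw [← huv i (hsub i hi), ← huv i₀ hi₀, smul_add, ha i (hsub i hi)]
          abel
        rw [this]
        exact sub_mem (hv i (hsub i hi)) (Submodule.smul_mem _ _ (hv i₀ hi₀)))
      (fun i hi j hj hij => sub_mem (hL i (hsub i hi) j (hsub j hj) hij)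
        (Submodule.smul_mem _ _ (hL i₀ hi₀ j (hsub j hj) (Finset.ne_of_mem_erase hj).symm)))
    refine ⟨i, hsub i hi, ?_⟩
    have := add_mem hmem (Submodule.smul_mem _ (a i)
      (hL i₀ hi₀ i (hsub i hi) (Finset.ne_of_mem_erase hi).symm))
    rwa [sub_add_cancel] at this

theorem IsLeftSerialRing.exists_bound (hR : IsLeftSerialRing R) :
    ∃ n : ℕ, ∀ (L : Fin (n + 1) → Submodule R R) (y : Fin (n + 1) → R),
      (∀ i j, i ≠ j → y i ∈ L j) → ∃ i, y i ∈ L i := by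
  obtain ⟨κ, hκ, U, -, sup, uni⟩ := hR
  refine ⟨Fintype.card κ, fun L y hL => ?_⟩
  obtain ⟨i, -, hi⟩ := exists_mem_of_forall_mem_of_ne uni L Finset.univ Finset.univ y
    (by simp) (fun i _ => by simp [sup]) (fun i _ j _ => hL i j)
  exact ⟨i, hi⟩

end Elimination

namespace LaurentSeries

variable {A : Type*} [Ring A]

/-- The Laurent series whose coefficients of exponent `n` lie in `I k` as soon as `n ≤ k ^ 2 + d`
and `k` is a large member of a given set `s`, for every `d`. -/
def squareGrowth (I : ℕ → Submodule A A) (s : Set ℕ) :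
    Submodule (LaurentSeries A) (LaurentSeries A) where
  carrier := {h | ∀ d : ℤ, ∃ K : ℕ, ∀ k ≥ K, k ∈ s → ∀ n : ℤ, n ≤ k ^ 2 + d → h.coeff n ∈ I k}
  zero_mem' _ := ⟨0, fun k _ _ _ _ => (I k).zero_mem⟩
  add_mem' {f g} hf hg d := by
    obtain ⟨K, hK⟩ := hf d
    obtain ⟨K', hK'⟩ := hg d
    exact ⟨max K K', fun k hk hks n hn => (I k).add_mem
      (hK k (le_of_max_le_left hk) hks n hn) (hK' k (le_of_max_le_right hk) hks n hn)⟩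
  smul_mem' f h hh d := by
    obtain ⟨p, hp⟩ := exists_forall_lt_coeff_eq_zero f
    obtain ⟨K, hK⟩ := hh (d - p)
    refine ⟨K, fun k hk hks n hn => coeff_mul_mem_s3 (I k).toAddSubgroup fun i j hij => ?_⟩
    rcases lt_or_ge i p with hi | hi
    · simp [hp i hi]
    · exact (I k).smul_mem _ (hK k hk hks j (by linarith))

open Classical in
/-- The Laurent series `∑ a k x ^ (k ^ 2)`, where `k` ranges over a set `s`. -/
noncomputable def squareSeries (a : ℕ → A) (s : Set ℕ) : LaurentSeries A :=
  HahnSeries.ofPowerSeries ℤ A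
    (PowerSeries.mk fun n => if n.sqrt ^ 2 = n ∧ n.sqrt ∈ s then a n.sqrt else 0)

theorem coeff_squareSeries_sq (a : ℕ → A) {s : Set ℕ} {k : ℕ} (hk : k ∈ s) :
    (squareSeries a s).coeff ((k : ℤ) ^ 2) = a k := by
  have : ((k : ℤ) ^ 2) = ((k ^ 2 : ℕ) : ℤ) := by push_cast; rfl
  rw [squareSeries, this, HahnSeries.ofPowerSeries_apply_coeff, PowerSeries.coeff_mk,
    Nat.sqrt_eq', if_pos ⟨rfl, hk⟩]

theorem coeff_squareSeries_mem (a : ℕ → A) (s : Set ℕ) (N : AddSubgroup A) {n : ℤ}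
    (h : ∀ k ∈ s, n = (k : ℤ) ^ 2 → a k ∈ N) : (squareSeries a s).coeff n ∈ N := by
  rw [squareSeries, PowerSeries.coeff_coe]
  split_ifs with hn
  · exact N.zero_mem
  · rw [PowerSeries.coeff_mk]
    split_ifs with h'
    · refine h _ h'.2 ?_
      have := congrArg (Nat.cast (R := ℤ)) h'.1
      push_cast at this
      rw [this]
      exact (abs_of_nonneg (not_lt.mp hn)).symm
    · exact N.zero_mem

theorem squareSeries_mem {I : ℕ → Submodule A A} (hI : Monotone I) {a : ℕ → A}
    (ha : ∀ k, a k ∈ I (k + 1)) {s t : Set ℕ} (hst : Disjoint s t) :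
    squareSeries a s ∈ squareGrowth I t := by
  intro d
  refine ⟨d.toNat, fun k hk hkt n hn => coeff_squareSeries_mem a s (I k).toAddSubgroup ?_⟩
  rintro l hls rfl
  have hlk : l ≠ k := fun h => Set.disjoint_left.mp hst hls (h ▸ hkt)
  have hd : d ≤ k := by omega
  have : l < k := by
    have : l < k + 1 := by
      by_contra! hcon
      have : ((k : ℤ) + 1) ≤ l := by exact_mod_cast hcon
      nlinarith
    omega
  exact hI (by omega : l + 1 ≤ k) (ha l)

theorem squareSeries_notMem {I : ℕ → Submodule A A} {a : ℕ → A} (ha : ∀ k, a k ∉ I k)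
    {s : Set ℕ} (hs : ∀ K, ∃ k ≥ K, k ∈ s) : squareSeries a s ∉ squareGrowth I s := by
  intro h
  obtain ⟨K, hK⟩ := h 0
  obtain ⟨k, hk, hks⟩ := hs K
  have := hK k hk hks (k ^ 2) (by simp)
  rw [coeff_squareSeries_sq a hks] at this
  exact ha k this

theorem isNoetherian_of_isLeftSerialRing (hB : IsLeftSerialRing (LaurentSeries A)) :
    IsNoetherian A A := by
  obtain ⟨N, hN⟩ := hB.exists_bound
  by_contra hcon
  rw [isNoetherian_iff, RelEmbedding.wellFounded_iff_isEmpty, not_isEmpty_iff] at hcon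
  obtain ⟨I⟩ := hcon
  have hI : StrictMono I := fun i j hij => I.map_rel_iff.mpr hij
  choose a ha ha' using fun k => SetLike.exists_of_lt (hI (Nat.lt_succ_self k))
  let s : Fin (N + 1) → Set ℕ := fun i => {k | k % (N + 1) = i}
  obtain ⟨i, hi⟩ := hN (fun i => squareGrowth I (s i)) (fun i => squareSeries a (s i))
    fun i j hij => squareSeries_mem hI.monotone ha <| Set.disjoint_left.mpr fun k hk hk' =>
      hij (Fin.ext (hk.symm.trans hk'))
  refine squareSeries_notMem ha' (fun K => ⟨(N + 1) * K + i, ?_, ?_⟩) hi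
  · nlinarith
  · simp [s, Nat.mod_eq_of_lt i.2]

end LaurentSeries

theorem one_mem_span_of_prod_mem_span {B S ι : Type*} [Ring B] [CommRing S] [DecidableEq ι]
    (φ : S →+* B) (c : ι → S) (h : ∀ i j, i ≠ j → ∃ b, b * φ (c i - c j) = 1) {i : ι}
    {s : Finset ι} (hi : i ∉ s) (hs : φ (∏ j ∈ s, c j) ∈ Submodule.span B {φ (c i)}) :
    1 ∈ Submodule.span B {φ (c i)} := by
  induction s using Finset.induction_on with
  | empty => simpa only [Finset.prod_empty, map_one] using hs
  | insert j s hj ih =>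
    obtain ⟨hij, his⟩ : i ≠ j ∧ i ∉ s := by simpa [not_or] using hi
    refine ih his ?_
    obtain ⟨b, hb⟩ := h j i hij.symm
    rw [Finset.prod_insert hj] at hs
    have : φ (∏ j ∈ s, c j) =
        b • (φ (c j * ∏ j ∈ s, c j) - φ (∏ j ∈ s, c j) • φ (c i)) := by
      rw [smul_eq_mul, smul_eq_mul, ← map_mul, ← map_sub, mul_comm _ (c i), ← sub_mul, map_mul,
        ← mul_assoc, hb, one_mul]
    rw [this]
    exact Submodule.smul_mem _ _ (sub_mem hs
      (Submodule.smul_mem _ _ (Submodule.mem_span_singleton_self _)))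

theorem IsLeftSerialRing.exists_mul_eq_one {B : Type*} [Ring B] (hB : IsLeftSerialRing B)
    {S : Type*} [CommRing S] (φ : S →+* B) (c : ℕ → S)
    (h : ∀ i j, i ≠ j → ∃ b, b * φ (c i - c j) = 1) : ∃ i b, b * φ (c i) = 1 := by
  obtain ⟨n, hn⟩ := hB.exists_bound
  obtain ⟨i, hi⟩ := hn (fun i => Submodule.span B {φ (c i)})
    (fun i => φ (∏ j ∈ Finset.univ.erase i, c j)) fun i j hij => by
      rw [← Finset.prod_erase_mul _ _ (Finset.mem_erase.mpr ⟨hij.symm, Finset.mem_univ j⟩), map_mul]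
      exact Submodule.smul_mem _ _ (Submodule.mem_span_singleton_self _)
  have := one_mem_span_of_prod_mem_span φ (fun i : Fin (n + 1) => c i)
    (fun i j hij => h _ _ (Fin.val_ne_of_ne hij)) (Finset.notMem_erase i Finset.univ) hi
  exact ⟨i, Submodule.mem_span_singleton.mp this⟩

namespace LaurentSeries

variable {A : Type*} [Ring A]

theorem exists_mul_single_sub_single_eq_one {p q : ℤ} (hpq : p ≠ q) :
    ∃ b : LaurentSeries A, b * (HahnSeries.single p 1 - HahnSeries.single q 1) = 1 := by
  refine exists_mul_eq (N := ⊤) (m := min p q) (fun n hn => ?_) (fun _ => Submodule.mem_top)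
    (fun z _ => ?_) fun _ => Submodule.mem_top
  · rw [HahnSeries.coeff_sub, HahnSeries.coeff_single_of_ne (by omega),
      HahnSeries.coeff_single_of_ne (by omega), sub_zero]
  · rcases lt_or_gt_of_ne hpq with h | h
    · refine ⟨z, ?_⟩
      rw [min_eq_left h.le, HahnSeries.coeff_sub, HahnSeries.coeff_single_same,
        HahnSeries.coeff_single_of_ne hpq, sub_zero, mul_one]
    · refine ⟨-z, ?_⟩
      rw [min_eq_right h.le, HahnSeries.coeff_sub, HahnSeries.coeff_single_same,
        HahnSeries.coeff_single_of_ne hpq.symm, zero_sub, neg_mul_neg, mul_one]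

theorem exists_mul_single_sub_C_eq_one (hB : IsLeftSerialRing (LaurentSeries A)) (a : A) :
    ∃ i : ℤ, 0 < i ∧ ∃ b : LaurentSeries A, b * (HahnSeries.single i 1 - HahnSeries.C a) = 1 := by
  let ψ : Polynomial ℤ →+* LaurentSeries A :=
    Polynomial.eval₂RingHom' (Int.castRingHom _) (HahnSeries.single 1 1)
      fun _ => Int.cast_commute _ _
  have hψ : ∀ n : ℕ, ψ (Polynomial.X ^ n) = HahnSeries.single (n : ℤ) 1 := fun n => by
    rw [map_pow]
    simp [ψ, HahnSeries.single_pow]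
  let φ : Polynomial (Polynomial ℤ) →+* LaurentSeries A :=
    Polynomial.eval₂RingHom' ψ (HahnSeries.C a) fun p => by
      induction p using Polynomial.induction_on with
      | C n => simp [ψ]
      | add p q hp hq => simpa using hp.add_left hq
      | monomial n m _ =>
        rw [map_mul, hψ]
        exact .mul_left (by simp [ψ]) (single_one_commute _ _)
  obtain ⟨i, b, hb⟩ := hB.exists_mul_eq_one φ
    (fun i => Polynomial.C (Polynomial.X ^ (i + 1)) - Polynomial.X) fun i j hij => by
      rw [sub_sub_sub_cancel_right, ← map_sub]
      simp only [φ, Polynomial.eval₂RingHom', RingHom.coe_mk, MonoidHom.coe_mk, OneHom.coe_mk,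
        Polynomial.eval₂_C]
      rw [map_sub, hψ, hψ]
      exact exists_mul_single_sub_single_eq_one (by omega)
  refine ⟨(i + 1 : ℕ), by omega, b, ?_⟩
  rw [← hb, map_sub]
  simp only [φ, Polynomial.eval₂RingHom', RingHom.coe_mk, MonoidHom.coe_mk, OneHom.coe_mk,
        Polynomial.eval₂_C, Polynomial.eval₂_X, hψ]

theorem isNilpotent_of_mem_jacobson (hB : IsLeftSerialRing (LaurentSeries A)) {a : A}
    (ha : a ∈ Ring.jacobson A) : IsNilpotent a := by
  obtain ⟨i, hi, b, hb⟩ := exists_mul_single_sub_C_eq_one hB a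
  have coeff : ∀ n, b.coeff (n - i) - b.coeff n * a = (1 : LaurentSeries A).coeff n := fun n => by
    rw [← hb, mul_sub, HahnSeries.coeff_sub, HahnSeries.coeff_mul_single, mul_one,
      HahnSeries.C_apply, HahnSeries.coeff_mul_single_zero]
  have hc : b.coeff (-i) = b.coeff 0 * a + 1 := by
    have := coeff 0
    rw [zero_sub, HahnSeries.coeff_one, if_pos rfl] at this
    rw [← this]
    abel
  have hpow : ∀ k : ℕ, b.coeff (-(k + 1) * i) = b.coeff (-i) * a ^ k := by
    intro k
    induction k with
    | zero => simp
    | succ k ih =>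
      have := coeff (-(k + 1) * i)
      rw [HahnSeries.coeff_one, if_neg (by nlinarith), sub_eq_zero, ih, mul_assoc,
        ← pow_succ] at this
      rw [← this]
      congr 1
      push_cast
      ring
  obtain ⟨p, hp⟩ := exists_forall_lt_coeff_eq_zero b
  rw [← Ideal.jacobson_bot, Ideal.mem_jacobson_iff] at ha
  obtain ⟨z, hz⟩ := ha (b.coeff 0)
  have hzc : z * b.coeff (-i) = 1 := by
    rw [Ideal.mem_bot, sub_eq_zero] at hz
    rw [hc, mul_add, mul_one, ← mul_assoc, hz]
  refine ⟨p.natAbs, ?_⟩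
  have hlt : -((p.natAbs : ℤ) + 1) * i < p := by
    have : -(p.natAbs : ℤ) ≤ p := by omega
    nlinarith
  rw [← one_mul (a ^ _), ← hzc, mul_assoc, ← hpow, hp _ hlt, mul_zero]

end LaurentSeries

section Nil

variable {A : Type*} [Ring A]

theorem Ideal.pow_le_pow_of_sq_le {I N : Ideal A} (h : ∀ x ∈ I, ∀ y ∈ I, x * y ∈ N) [I.IsTwoSided]
    (k : ℕ) : I ^ (2 * k) ≤ N ^ k := by
  induction k with
  | zero => rw [mul_zero, Submodule.pow_zero, Submodule.pow_zero]
  | succ k ih =>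
    rw [mul_add_one, Ideal.IsTwoSided.pow_add, Submodule.pow_succ]
    refine Ideal.mul_mono ih ?_
    rw [Submodule.pow_one]
    exact Ideal.mul_le.mpr fun x hx y hy => h x hx y hy

/-- If `c A c ⊆ N`, then `c` lies in a two-sided ideal whose square is contained in `N`. -/
theorem Ideal.exists_isTwoSided_of_forall_mul_mul_mem {N : Ideal A} [N.IsTwoSided] {c : A}
    (hc : ∀ b, c * b * c ∈ N) :
    ∃ I : Ideal A, I.IsTwoSided ∧ N ≤ I ∧ c ∈ I ∧ ∀ x ∈ I, ∀ y ∈ I, x * y ∈ N := by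
  let T : Ideal A :=
    { carrier := {x | ∀ b, x * b * c ∈ N}
      zero_mem' b := by simp
      add_mem' hx hy b := by simpa only [add_mul] using N.add_mem (hx b) (hy b)
      smul_mem' a x hx b := by
        simpa only [smul_eq_mul, mul_assoc] using N.mul_mem_left a (hx b) }
  let T' : Ideal A :=
    { carrier := {y | ∀ x ∈ T, ∀ b, x * b * y ∈ N}
      zero_mem' x _ b := by simp
      add_mem' hx hy z hz b := by
        simpa only [mul_add] using N.add_mem (hx z hz b) (hy z hz b)
      smul_mem' a y hy x hx b := by
        simpa only [smul_eq_mul, mul_assoc] using hy x hx (b * a) }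
  refine ⟨T ⊓ T', ⟨fun {a} b ha => ⟨fun d => ?_, fun x hx d => ?_⟩⟩, fun x hx =>
    ⟨fun b => ?_, fun y _ b => N.mul_mem_left _ hx⟩, ⟨hc, fun x hx => hx⟩, fun x hx y hy => ?_⟩
  · simpa only [mul_assoc] using ha.1 (b * d)
  · simpa only [mul_assoc] using N.mul_mem_right b (ha.2 x hx d)
  · exact N.mul_mem_right _ (N.mul_mem_right _ hx)
  · simpa only [mul_one] using hy.2 x hx.1 1

/-- **Levitzki's theorem**: a nil ideal in a left Noetherian ring is nilpotent. -/
theorem Ideal.isNilpotent_of_forall_isNilpotent [IsNoetherian A A] {J : Ideal A} [J.IsTwoSided]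
    (hJ : ∀ a ∈ J, IsNilpotent a) : IsNilpotent J := by
  obtain ⟨N, ⟨hN, hNnil⟩, hmax⟩ := WellFounded.has_min
    (wellFounded_gt (α := Submodule A A)) {N : Ideal A | N.IsTwoSided ∧ IsNilpotent N}
    ⟨⊥, inferInstance, 1, by rw [Submodule.pow_one, Ideal.zero_eq_bot]⟩
  suffices hle : J ≤ N by
    obtain ⟨n, hn⟩ := hNnil
    exact ⟨n, le_bot_iff.mp ((Ideal.pow_right_mono hle n).trans hn.le)⟩
  by_contra hJN
  let l : A → Submodule A A := fun c => N.comap (LinearMap.toSpanSingleton A A c)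
  have hl : ∀ {a c}, a ∈ l c ↔ a * c ∈ N := Iff.rfl
  obtain ⟨_, ⟨c, ⟨hcJ, hcN⟩, rfl⟩, hcmax⟩ := WellFounded.has_min
    (wellFounded_gt (α := Submodule A A)) (l '' {c | c ∈ J ∧ c ∉ N})
    (Set.Nonempty.image _ (SetLike.not_le_iff_exists.mp hJN))
  have key : ∀ b, c * b * c ∈ N := by
    intro b
    by_cases hcb : c * b ∈ N
    · exact Ideal.mul_mem_right _ N hcb
    have hex : ∃ k, (c * b) ^ (k + 1) ∈ N := by
      obtain ⟨k, hk⟩ := hJ (c * b) (J.mul_mem_right _ hcJ)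
      exact ⟨k, by rw [pow_succ, hk, zero_mul]; exact N.zero_mem⟩
    classical
    obtain ⟨k, hk⟩ : ∃ k, Nat.find hex = k + 1 := Nat.exists_eq_succ_of_ne_zero fun h0 => hcb <| by
      have := Nat.find_spec hex
      rwa [h0, zero_add, pow_one] at this
    have hkN : (c * b) ^ (k + 1) ∉ N := Nat.find_min hex (by omega)
    have hkN' : (c * b) * (c * b) ^ (k + 1) ∈ N := by
      rw [← pow_succ', ← hk]
      exact Nat.find_spec hex
    have hle : l c ≤ l ((c * b) ^ (k + 1)) := fun a ha => by
      rw [hl] at ha ⊢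
      rw [pow_succ', ← mul_assoc, ← mul_assoc]
      exact Ideal.mul_mem_right _ N (Ideal.mul_mem_right _ N ha)
    have hkJ : (c * b) ^ (k + 1) ∈ J := by
      rw [pow_succ']
      exact J.mul_mem_right _ (J.mul_mem_right _ hcJ)
    have heq : l c = l ((c * b) ^ (k + 1)) := by
      by_contra hne
      exact hcmax _ ⟨_, ⟨hkJ, hkN⟩, rfl⟩ (lt_of_le_of_ne hle hne)
    exact hl.mp (heq ▸ hl.mpr hkN')
  obtain ⟨I, hI, hNI, hcI, hIN⟩ := Ideal.exists_isTwoSided_of_forall_mul_mul_mem key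
  refine hmax I ⟨hI, ?_⟩ (lt_of_le_of_ne hNI fun h => hcN (h ▸ hcI))
  obtain ⟨n, hn⟩ := hNnil
  exact ⟨2 * n, le_bot_iff.mp ((Ideal.pow_le_pow_of_sq_le hIN n).trans hn.le)⟩

end Nil

section Semilocal

variable {A : Type*} [Ring A]

theorem exists_finset_inf_le_of_isCoatom {n : ℕ}
    (hn : ∀ (L : Fin (n + 1) → Submodule A A) (y : Fin (n + 1) → A),
      (∀ i j, i ≠ j → y i ∈ L j) → ∃ i, y i ∈ L i) :
    ∃ s : Finset (Submodule A A), (∀ M ∈ s, IsCoatom M) ∧ ∀ M, IsCoatom M → s.inf id ≤ M := by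
  classical
  let P : Finset (Submodule A A) → Prop := fun s => (∀ M ∈ s, IsCoatom M) ∧
    ∀ M ∈ s, ∃ y ∉ M, ∀ M' ∈ s, M' ≠ M → y ∈ M'
  have hcard : ∀ s, P s → s.card ≤ n := by
    intro s hs
    by_contra! hcon
    obtain ⟨e⟩ : Nonempty (Fin (n + 1) ↪ s) := Function.Embedding.nonempty_of_card_le (by simpa)
    choose! y hy hy' using hs.2
    obtain ⟨i, hi⟩ := hn (fun i => e i) (fun i => y (e i)) fun i j hij =>
      hy' _ (e i).2 _ (e j).2 fun h => hij (e.injective (Subtype.ext h)).symm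
    exact hy _ (e i).2 hi
  obtain ⟨k, ⟨s, hs, rfl⟩, hmax⟩ : ∃ k, (∃ s, P s ∧ s.card = k) ∧ ∀ s, P s → s.card ≤ k := by
    have hex : ∃ k, ∃ s, P s ∧ s.card = k := ⟨0, ∅, by simp [P], rfl⟩
    have hb : ∀ k, (∃ s, P s ∧ s.card = k) → k ≤ n := by
      rintro _ ⟨s, hs, rfl⟩
      exact hcard s hs
    obtain ⟨k₀, hk₀⟩ := hex
    refine ⟨Nat.findGreatest (fun k => ∃ s, P s ∧ s.card = k) n,
      Nat.findGreatest_spec (P := fun k => ∃ s, P s ∧ s.card = k) (hb k₀ hk₀) hk₀,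
      fun s hs => Nat.le_findGreatest (hcard s hs) ⟨s, hs, rfl⟩⟩
  refine ⟨s, hs.1, fun M hM => ?_⟩
  by_contra hle
  have hMs : M ∉ s := fun h => hle (Finset.inf_le (f := id) h)
  have hP : P (insert M s) := by
    refine ⟨fun M' hM' => ?_, fun M' hM' => ?_⟩
    · rcases Finset.mem_insert.mp hM' with rfl | hM'
      exacts [hM, hs.1 _ hM']
    rcases Finset.mem_insert.mp hM' with rfl | hM'
    · obtain ⟨y, hy, hy'⟩ := SetLike.not_le_iff_exists.mp hle
      refine ⟨y, hy', fun X hX hne => ?_⟩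
      exact (Finset.inf_le (f := id) ((Finset.mem_insert.mp hX).resolve_left hne) :
        s.inf id ≤ X) hy
    · obtain ⟨y, hy, hy'⟩ := hs.2 M' hM'
      have htop : s.inf id ⊔ M = ⊤ := hM.2 _ (lt_of_le_of_ne le_sup_right fun h =>
        hle (h ▸ le_sup_left))
      obtain ⟨d, hd, m, hm, rfl⟩ := Submodule.mem_sup.mp (htop ▸ Submodule.mem_top : y ∈ _)
      have hdX : ∀ X ∈ s, d ∈ X := fun X hX => (Finset.inf_le (f := id) hX : s.inf id ≤ X) hd
      refine ⟨m, fun h => hy (add_mem (hdX _ hM') h), fun X hX hne => ?_⟩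
      rcases Finset.mem_insert.mp hX with rfl | hX
      · exact hm
      · exact (Submodule.add_mem_iff_right _ (hdX X hX)).mp (hy' X hX hne)
  have := hmax _ hP
  rw [Finset.card_insert_of_notMem hMs] at this
  omega

theorem isSemisimpleRing_quotient_jacobson_of_finset (s : Finset (Submodule A A))
    (hs : ∀ M ∈ s, IsCoatom M) (h : ∀ M, IsCoatom M → s.inf id ≤ M) :
    IsSemisimpleRing (A ⧸ Ring.jacobson A) := by
  have hJ : Ring.jacobson A = s.inf id := by
    refine le_antisymm (Finset.le_inf fun M hM => sInf_le (hs M hM)) (le_sInf h)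
  have : ∀ M : s, IsSimpleModule A (A ⧸ M.1) := fun M =>
    isSimpleModule_iff_isCoatom.mpr (hs _ M.2)
  let f : A →ₗ[A] (∀ M : s, A ⧸ M.1) := LinearMap.pi fun M => M.1.mkQ
  have hf : LinearMap.ker f = Ring.jacobson A := by
    rw [LinearMap.ker_pi, hJ, Finset.inf_eq_iInf, iInf_subtype]
    simp only [Submodule.ker_mkQ, id]
  have ss : IsSemisimpleModule A (A ⧸ Ring.jacobson A) :=
    .of_injective ((Ring.jacobson A).liftQ f hf.ge) (LinearMap.ker_eq_bot.mp
      (Submodule.ker_liftQ_eq_bot _ _ _ hf.le))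
  let g : (A ⧸ Ring.jacobson A) →ₛₗ[Ideal.Quotient.mk (Ring.jacobson A)] (A ⧸ Ring.jacobson A) :=
    { toFun := id
      map_add' := fun _ _ => rfl
      map_smul' := fun a x => by
        obtain ⟨x, rfl⟩ := Ideal.Quotient.mk_surjective x
        rfl }
  exact (g.isSemisimpleModule_iff_of_bijective Function.bijective_id).mp ss

end Semilocal

namespace LaurentSeries

variable {A : Type*} [Ring A]

theorem isSemiprimaryRing_of_isLeftSerialRing (hB : IsLeftSerialRing (LaurentSeries A)) :
    IsSemiprimaryRing A where
  isSemisimpleRing := by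
    obtain ⟨n, hn⟩ := hB.exists_bound
    obtain ⟨s, hs, hs'⟩ := exists_finset_inf_le_of_isCoatom (A := A) (n := n) fun L y h => by
      simpa only [C_mem_extend] using
        hn (fun i => extend (L i)) (fun i => HahnSeries.C (y i)) fun i j hij =>
          C_mem_extend.mpr (h i j hij)
    exact isSemisimpleRing_quotient_jacobson_of_finset s hs hs'
  isNilpotent :=
    have := isNoetherian_of_isLeftSerialRing hB
    Ideal.isNilpotent_of_forall_isNilpotent fun _ => isNilpotent_of_mem_jacobson hB

theorem isArtinian_of_isLeftSerialRing (hB : IsLeftSerialRing (LaurentSeries A)) :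
    IsArtinian A A := by
  have := isSemiprimaryRing_of_isLeftSerialRing hB
  exact (IsSemiprimaryRing.isNoetherian_iff_isArtinian (R := A)).mp
    (isNoetherian_of_isLeftSerialRing hB)

end LaurentSeries

section Primitive

variable {A : Type*} [Ring A]

theorem IsSemisimpleRing.exists_completeOrthogonalIdempotents (R : Type*) [Ring R]
    [IsSemisimpleRing R] : ∃ (n : ℕ) (e : Fin n → R), CompleteOrthogonalIdempotents e ∧
      ∀ i, IsAtom (Submodule.span R {e i}) := by
  obtain ⟨s, ind, sup, simple⟩ := IsSemisimpleModule.exists_sSupIndep_sSup_simples_eq_top R R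
  have := (WellFoundedGT.finite_of_sSupIndep ind).to_subtype
  let σ := (Finite.equivFin s).symm
  obtain ⟨e, he, hs⟩ := exists_completeOrthogonalIdempotents_of_iSupIndep
    (N := fun i => (σ i).1) (((sSupIndep_iff s).mp ind).comp σ.injective)
    (by rw [σ.iSup_comp (g := fun M : s => M.1), ← sSup_eq_iSup', sup])
  refine ⟨_, e, he, fun i => ?_⟩
  rw [← hs, ← isSimpleModule_iff_isAtom]
  exact simple _ (σ i).2

theorem exists_mul_eq_of_isAtom {J : Ideal A} [J.IsTwoSided] (hJ : IsNilpotent J) {e : A}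
    (he : IsIdempotentElem e) (hatom : IsAtom (Submodule.span (A ⧸ J) {Ideal.Quotient.mk J e}))
    {y : A} (hye : y * e = y) (hyJ : y ∉ J) : ∃ a, a * y = e := by
  have hmem : Ideal.Quotient.mk J y ∈ Submodule.span (A ⧸ J) {Ideal.Quotient.mk J e} :=
    Submodule.mem_span_singleton.mpr ⟨Ideal.Quotient.mk J y, by
      rw [smul_eq_mul, ← map_mul, hye]⟩
  have heq := (hatom.le_iff_eq (by
    rwa [Ne, Submodule.span_singleton_eq_bot, Ideal.Quotient.eq_zero_iff_mem])).mp
      ((Submodule.span_singleton_le_iff_mem _ _).mpr hmem)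
  obtain ⟨b, hb⟩ := Submodule.mem_span_singleton.mp
    (heq ▸ Submodule.mem_span_singleton_self (Ideal.Quotient.mk J e))
  obtain ⟨b, rfl⟩ := Ideal.Quotient.mk_surjective b
  rw [smul_eq_mul, ← map_mul, Ideal.Quotient.eq] at hb
  refine Submodule.mem_span_singleton.mp <| (Submodule.span_singleton_le_iff_mem _ _).mp <|
    Submodule.le_of_le_sup_smul_of_isNilpotent (N := Submodule.span A {e}) hJ ?_
  rw [Submodule.span_singleton_le_iff_mem]
  have : e = b * y - (b * y - e) * e := by rw [sub_mul, mul_assoc, hye, he.eq, sub_sub_cancel]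
  have hmem' : b * y - (b * y - e) * e ∈
      Submodule.span A {y} ⊔ J • Submodule.span A {e} :=
    Submodule.sub_mem_sup
      (Submodule.smul_mem _ b (Submodule.mem_span_singleton_self y))
      (Submodule.smul_mem_smul hb (Submodule.mem_span_singleton_self e))
  rwa [← this] at hmem'

theorem exists_mul_eq_right_of_forall_exists_mul_eq {J : Ideal A} [J.IsTwoSided] {e : A}
    (he : IsIdempotentElem e) (h : ∀ y, y * e = y → y ∉ J → ∃ a, a * y = e) {g : A}
    (hge : g * e = g) (heg : e * g = g) (hg : g ∉ J) : ∃ a, g * a = e := by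
  obtain ⟨a, ha⟩ := h g hge hg
  have h1 : e * a * e * g = e := by rw [mul_assoc, heg, mul_assoc, ha, he.eq]
  obtain ⟨b, hb⟩ := h (e * a * e) (by rw [mul_assoc, he.eq]) fun hJ => hg <| by
    rw [← heg, ← h1, mul_assoc]
    exact J.mul_mem_right _ hJ
  refine ⟨e * a * e, ?_⟩
  have h2 : g = b * e := by
    calc g = b * (e * a * e) * g := by rw [hb, heg]
      _ = b * e := by rw [mul_assoc, h1]
  rw [h2, mul_assoc, ← mul_assoc e, ← mul_assoc e, he.eq, hb]

end Primitive

namespace LaurentSeries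

variable {A : Type*} [Ring A]

theorem eq_zero_of_mul_eq_zero_s3 {J : Ideal A} [J.IsTwoSided] (hJ : IsNilpotent J) {e : A}
    {y g : LaurentSeries A} (hye : ∀ n, y.coeff n * e = y.coeff n) (hgJ : g ∉ extend J)
    (hg : ∀ n, g.coeff n ∉ J → ∃ a, g.coeff n * a = e) (hyg : y * g = 0) : y = 0 := by
  have key : ∀ k, y ∈ extend (J ^ k) := by
    intro k
    induction k with
    | zero =>
      rw [Submodule.pow_zero, Ideal.one_eq_top]
      exact fun _ => Submodule.mem_top
    | succ k ih =>
      by_contra hcon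
      obtain ⟨m, hm, hm'⟩ := exists_min_coeff y (· ∉ J ^ (k + 1)) (by simp)
        (by simpa only [mem_extend, not_forall] using hcon)
      obtain ⟨n, hn, hn'⟩ := exists_min_coeff g (· ∉ J) (by simp)
        (by simpa only [mem_extend, not_forall] using hgJ)
      simp only [not_not] at hm' hn'
      have := coeff_mul_sub_mem (f := y) (g := g) m n (J ^ (k + 1)).toAddSubgroup
        fun i j hij him => by
          rcases lt_or_gt_of_ne him with h | h
          · exact Ideal.mul_mem_right _ (J ^ (k + 1)) (hm' i h)
          · exact Ideal.mul_mem_mul (ih i) (hn' j (by omega))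
      rw [hyg, HahnSeries.coeff_zero, zero_sub, neg_mem_iff] at this
      obtain ⟨a, ha⟩ := hg n hn
      refine hm ?_
      rw [← hye, ← ha, ← mul_assoc]
      exact Ideal.mul_mem_right _ (J ^ (k + 1)) this
  obtain ⟨n, hn⟩ := hJ
  have := key n
  rwa [hn, Ideal.zero_eq_bot, extend_bot, Submodule.mem_bot] at this

theorem isUniserialModule_of_extend {N : Submodule A A}
    (h : IsUniserialModule (LaurentSeries A) (extend N)) : IsUniserialModule A N := by
  rw [isUniserialModule_submodule_iff] at *
  have key : ∀ X Y : Submodule A A, extend X ≤ extend Y → X ≤ Y := fun X Y hXY x hx =>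
    C_mem_extend.mp (hXY (C_mem_extend.mpr hx))
  exact fun X hX Y hY => (h _ (extend_mono hX) _ (extend_mono hY)).imp (key X Y) (key Y X)

theorem isUniserialModule_span_C {ι : Type*} [Fintype ι] {u : ι → LaurentSeries A}
    (hu : CompleteOrthogonalIdempotents u)
    (huni : ∀ i, IsUniserialModule (LaurentSeries A) (Submodule.span (LaurentSeries A) {u i}))
    {J : Ideal A} [J.IsTwoSided] (hJ : IsNilpotent J) {e : A} (he : IsIdempotentElem e)
    (heJ : e ∉ J) (h : ∀ y, y * e = y → y ∉ J → ∃ a, a * y = e) :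
    IsUniserialModule (LaurentSeries A) (extend (Submodule.span A {e})) := by
  obtain ⟨i, hi⟩ : ∃ i, HahnSeries.C e * u i * HahnSeries.C e ∉ extend J := by
    by_contra! hcon
    refine heJ (C_mem_extend.mp ?_)
    have : (HahnSeries.C e : LaurentSeries A) =
        ∑ i, HahnSeries.C e * u i * HahnSeries.C e := by
      rw [← Finset.sum_mul, ← Finset.mul_sum, hu.complete, mul_one, ← map_mul, he.eq]
    rw [this]
    exact sum_mem fun i _ => hcon i
  have hcoeff : ∀ n, (HahnSeries.C e * u i * HahnSeries.C e).coeff n = e * (u i).coeff n * e := by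
    intro n
    rw [HahnSeries.C_apply, HahnSeries.coeff_mul_single_zero, HahnSeries.coeff_single_zero_mul]
  have hC : ∀ y ∈ extend (Submodule.span A {e}), ∀ n, y.coeff n * e = y.coeff n := by
    intro y hy n
    obtain ⟨a, ha⟩ := Submodule.mem_span_singleton.mp (hy n)
    rw [← ha, smul_eq_mul, mul_assoc, he.eq]
  have inj : ∀ y ∈ extend (Submodule.span A {e}), y * u i = 0 → y = 0 := by
    intro y hy hyu
    refine eq_zero_of_mul_eq_zero_s3 hJ (hC y hy) hi (fun n hn => ?_) ?_
    · rw [hcoeff] at hn ⊢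
      exact exists_mul_eq_right_of_forall_exists_mul_eq he h (by rw [mul_assoc, he.eq])
        (by rw [← mul_assoc, ← mul_assoc, he.eq]) hn
    · have hye : y * HahnSeries.C e = y := by
        ext n
        rw [HahnSeries.C_apply, HahnSeries.coeff_mul_single_zero, hC y hy]
      rw [← mul_assoc, ← mul_assoc, hye, hyu, zero_mul]
  rw [isUniserialModule_submodule_iff_mem]
  have key : ∀ y ∈ extend (Submodule.span A {e}), ∀ z ∈ extend (Submodule.span A {e}),
      y * u i ∈ Submodule.span (LaurentSeries A) {z * u i} →
        y ∈ Submodule.span (LaurentSeries A) {z} := by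
    intro y hy z hz hyz
    obtain ⟨b, hb⟩ := Submodule.mem_span_singleton.mp hyz
    refine Submodule.mem_span_singleton.mpr ⟨b, (sub_eq_zero.mp
      (inj (y - b • z) (sub_mem hy (Submodule.smul_mem _ b hz)) ?_)).symm⟩
    rw [sub_mul, ← hb, smul_eq_mul, smul_eq_mul, mul_assoc, sub_self]
  intro y hy z hz
  refine ((isUniserialModule_submodule_iff_mem _).mp (huni i) (y * u i) ?_ (z * u i) ?_).imp
    (key y hy z hz) (key z hz y hy) <;>
  exact Submodule.smul_mem _ _ (Submodule.mem_span_singleton_self _)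

theorem isLeftSerialRing_of_isLeftSerialRing (hB : IsLeftSerialRing (LaurentSeries A)) :
    IsLeftSerialRing A := by
  have := isSemiprimaryRing_of_isLeftSerialRing hB
  have hJ := IsSemiprimaryRing.isNilpotent (R := A)
  obtain ⟨ι, hι, u, hu, huni⟩ := isLeftSerialRing_iff_exists_idempotents.mp hB
  obtain ⟨n, e, he, hatom⟩ :=
    IsSemisimpleRing.exists_completeOrthogonalIdempotents (A ⧸ Ring.jacobson A)
  obtain ⟨e, he', rfl⟩ := CompleteOrthogonalIdempotents.lift_of_isNilpotent_ker
    (Ideal.Quotient.mk (Ring.jacobson A))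
    (fun x hx => isNilpotent_of_mem_jacobson hB (by rwa [Ideal.mk_ker] at hx)) he
    fun i => Ideal.Quotient.mk_surjective _
  refine isLeftSerialRing_iff_exists_idempotents.mpr ⟨Fin n, inferInstance, e, he', fun i =>
    isUniserialModule_of_extend <| isUniserialModule_span_C hu huni hJ (he'.idem i) (fun h => ?_)
      fun y => exists_mul_eq_of_isAtom hJ (he'.idem i) (hatom i)⟩
  exact (hatom i).1 (by
    rw [Submodule.span_singleton_eq_bot, Function.comp_apply, Ideal.Quotient.eq_zero_iff_mem.mpr h])

theorem isLeftSerialRing_iff :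
    IsLeftSerialRing (LaurentSeries A) ↔ IsLeftSerialRing A ∧ IsArtinian A A :=
  ⟨fun h => ⟨isLeftSerialRing_of_isLeftSerialRing h, isArtinian_of_isLeftSerialRing h⟩,
    fun ⟨h, _⟩ => isLeftSerialRing_of_isArtinian h⟩

theorem isRightSerialRing_iff :
    IsRightSerialRing (LaurentSeries A) ↔ IsRightSerialRing A ∧ IsArtinian Aᵐᵒᵖ A := by
  rw [isRightSerialRing_iff_op, isRightSerialRing_iff_op,
    (opRingEquiv A).isLeftSerialRing_iff, isLeftSerialRing_iff,
    (opSelfLinearEquiv A).isArtinian_iff]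

end LaurentSeries

/-- The Laurent series ring `A((x))` is a serial ring (right and left serial)
if and only if `A` is a serial ring that is Artinian (right and left Artinian). -/
theorem laurentSeries_serial_iff (A : Type*) [Ring A] :
    (IsRightSerialRing (LaurentSeries A) ∧ IsLeftSerialRing (LaurentSeries A)) ↔
      (IsRightSerialRing A ∧ IsLeftSerialRing A ∧
        IsArtinian Aᵐᵒᵖ A ∧ IsArtinian A A) := by
  rw [LaurentSeries.isRightSerialRing_iff, LaurentSeries.isLeftSerialRing_iff]
  tauto
end
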